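/- arXiv:1508.07451 — 2 statements merged into one kernel-verified Lean document; each statement's English description precedes it below -/
import Mathlib

section
/- For integers p, q ≥ 2, there exists a tight chiral rotation pair of type (p, q) if and only if at least one of the following holds: (1) q is odd, p is even, p divides 2q, and there is an odd prime m such that m divides p and m² divides q; (2) p is odd, q is even, q divides 2p, and there is an odd prime m such that m divides q and m² divides p; (3) p and q are both even and there is an odd prime m such that m divides p and m² divides q; (4) p and q are both even and there is an odd prime m such that m divides q and m² divides p; (5) 8 divides p and 32 divides q; (6) 8 divides q and 32 divides p. -/
/-- A rotation pair of type `(p, q)`: the group is generated by `a` and `b`,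
`a` has order `p`, `b` has order `q`, `p, q ≥ 2`, `(a*b)^2 = 1`, and the cyclic
subgroups generated by `a` and `b` intersect trivially. -/
def IsRotPair {G : Type*} [Group G] (a b : G) (p q : ℕ) : Prop :=
  Subgroup.closure ({a, b} : Set G) = ⊤ ∧ orderOf a = p ∧ orderOf b = q ∧
    2 ≤ p ∧ 2 ≤ q ∧ (a * b) ^ 2 = 1 ∧
    Subgroup.zpowers a ⊓ Subgroup.zpowers b = ⊥

/-- Tightness: every element is `a ^ i * b ^ j` for some integers `i, j`. -/
def IsTight {G : Type*} [Group G] (a b : G) : Prop :=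
  ∀ g : G, ∃ i j : ℤ, g = a ^ i * b ^ j

/-- Orientably regular: some group automorphism inverts both generators. -/
def IsOrientablyRegular {G : Type*} [Group G] (a b : G) : Prop :=
  ∃ φ : G ≃* G, φ a = a⁻¹ ∧ φ b = b⁻¹

/-- Chiral: no group automorphism inverts both generators. -/
def IsChiral {G : Type*} [Group G] (a b : G) : Prop :=
  ¬ IsOrientablyRegular a b

/-- `(G, a, b)` covers `(H, a', b')` if a homomorphism sends `a ↦ a'`, `b ↦ b'`. -/
def Covers {G H : Type*} [Group G] [Group H] (a b : G) (a' b' : H) : Prop :=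
  ∃ f : G →* H, f a = a' ∧ f b = b'

/-- An atomic chiral rotation pair of type `(p, q)`: a tight chiral rotation pair
covering no tight chiral rotation pair of type `(p', q)` with `p' < p` nor one of
type `(p, q')` with `q' < q`. -/
def IsAtomicPair {G : Type*} [Group G] (a b : G) (p q : ℕ) : Prop :=
  IsRotPair a b p q ∧ IsTight a b ∧ IsChiral a b ∧
  (∀ (H : Type) (instH : Group H) (_ : Finite H) (a' b' : H) (p' : ℕ), p' < p →
      @IsRotPair H instH a' b' p' q → @IsTight H instH a' b' → @IsChiral H instH a' b' →
      ¬ @Covers G H _ instH a b a' b') ∧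
  (∀ (H : Type) (instH : Group H) (_ : Finite H) (a' b' : H) (q' : ℕ), q' < q →
      @IsRotPair H instH a' b' p q' → @IsTight H instH a' b' → @IsChiral H instH a' b' →
      ¬ @Covers G H _ instH a b a' b')

/-- Tight pair without the lower bounds on the orders. -/
structure TP {G : Type*} [Group G] (a b : G) : Prop where
  inv : (a * b) ^ 2 = 1
  disj : ∀ i j : ℤ, a ^ i = b ^ j → a ^ i = 1
  tight : ∀ g : G, ∃ i j : ℤ, g = a ^ i * b ^ j

/-- word form of regularity -/
def RegP {G : Type*} [Group G] (a b : G) : Prop :=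
  ∀ i x y : ℤ, b * a ^ i = a ^ x * b ^ y → b⁻¹ * a ^ (-i) = a ^ (-x) * b ^ (-y)

/-- word form of regularity modulo the kernel of a homomorphism -/
def RegMod {G H : Type*} [Group G] [Group H] (a b : G) (f : G →* H) : Prop :=
  ∀ i x y : ℤ, b * a ^ i = a ^ x * b ^ y → f (b⁻¹ * a ^ (-i)) = f (a ^ (-x) * b ^ (-y))

section basics
variable {G : Type*} [Group G] {a b : G}

theorem TP.disj' (h : TP a b) {i j : ℤ} (e : a ^ i = b ^ j) : a ^ i = 1 ∧ b ^ j = 1 :=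
  ⟨h.disj i j e, e ▸ h.disj i j e⟩

theorem TP.uniq (h : TP a b) {i j x y : ℤ} (e : a ^ i * b ^ j = a ^ x * b ^ y) :
    a ^ i = a ^ x ∧ b ^ j = b ^ y := by
  have e1 : a ^ (i - x) = b ^ (y - j) := by
    rw [zpow_sub, zpow_sub, (Commute.refl a).zpow_zpow i _ |>.inv_right.eq, eq_mul_inv_iff_mul_eq,
      mul_assoc, e, inv_mul_cancel_left]
  obtain ⟨h1, h2⟩ := h.disj' e1
  rw [zpow_sub, mul_inv_eq_one] at h1 h2
  exact ⟨h1, h2.symm⟩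

theorem TP.symm (h : TP a b) : TP b a := by
  refine ⟨?_, ?_, ?_⟩
  · have := h.inv
    rw [pow_two] at this ⊢
    have e : b * a * (b * a) = a⁻¹ * (a * b * (a * b)) * a := by group
    rw [e, this]; group
  · intro i j e
    exact (h.disj' e.symm).2
  · intro g
    obtain ⟨i, j, e⟩ := h.tight g⁻¹
    refine ⟨-j, -i, ?_⟩
    rw [← inv_inv g, e]; group

theorem TP.rel (h : TP a b) : b * a = a⁻¹ * b⁻¹ := by
  have := h.inv
  rw [pow_two] at this
  have e : b * a = a⁻¹ * (a * b * (a * b)) * b⁻¹ := by group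
  rw [e, this]; group

theorem TP.rel' (h : TP a b) : b * a * b⁻¹ = a⁻¹ * (b ^ 2)⁻¹ := by
  rw [h.rel]; group

/-- closure of a stabiliser set under generation -/
theorem TP.induct [Finite G] (h : TP a b) (S : Submonoid G) (ha : a ∈ S) (hb : b ∈ S) (g : G) :
    g ∈ S := by
  obtain ⟨i, j, rfl⟩ := h.tight g
  have key : ∀ (x : G) (i : ℤ), x ∈ S → x ^ i ∈ S := by
    intro x i hx
    have : x ^ i ∈ Subgroup.zpowers x := ⟨i, rfl⟩
    rw [← mem_powers_iff_mem_zpowers] at this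
    obtain ⟨n, hn⟩ := this
    rw [← hn]
    exact S.pow_mem hx n
  exact S.mul_mem (key _ _ ha) (key _ _ hb)

theorem TP.normal [Finite G] (h : TP a b) (K : Subgroup G) (ha : ∀ x ∈ K, a * x * a⁻¹ ∈ K)
    (hb : ∀ x ∈ K, b * x * b⁻¹ ∈ K) : K.Normal := by
  constructor
  intro n hn g
  have := h.induct
    { carrier := {g | ∀ x ∈ K, g * x * g⁻¹ ∈ K}
      one_mem' := by intro x hx; simpa using hx
      mul_mem' := by
        intro u v hu hv x hx
        have := hu _ (hv x hx)
        have e : u * v * x * (u * v)⁻¹ = u * (v * x * v⁻¹) * u⁻¹ := by group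
        rw [e]; exact this } ha hb g
  exact this n hn

theorem zpow_mem_zp {a : G} [Finite G] {i j : ℤ} (e : orderOf (a ^ i) = orderOf (a ^ j)) :
    a ^ j ∈ Subgroup.zpowers (a ^ i) := by
  set p := orderOf a with hp
  have hp0 : 0 < p := orderOf_pos a
  set g : ℕ := Int.gcd i p with hg
  have hgp : g ∣ p := by
    have := Int.gcd_dvd_right i (p : ℤ); exact_mod_cast this
  obtain ⟨u, hu⟩ := hgp
  have hu0 : 0 < u := by
    rcases Nat.eq_zero_or_pos u with h | h
    · subst h; omega
    · exact h
  obtain ⟨v, hv⟩ : (g : ℤ) ∣ i := Int.gcd_dvd_left i (p : ℤ)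
  have h1 : orderOf (a ^ i) ∣ u := by
    apply orderOf_dvd_of_pow_eq_one
    rw [← zpow_natCast, ← zpow_mul, ← orderOf_dvd_iff_zpow_eq_one, ← hp, hu, hv]
    push_cast
    exact ⟨v, by ring⟩
  have h2 : (p : ℤ) ∣ j * u := by
    rw [hp, orderOf_dvd_iff_zpow_eq_one, zpow_mul, zpow_natCast]
    rw [e] at h1
    exact orderOf_dvd_iff_pow_eq_one.1 h1
  have h3 : (g : ℤ) ∣ j := by
    rw [hu] at h2
    push_cast at h2
    exact Int.dvd_of_mul_dvd_mul_right (by exact_mod_cast hu0.ne') h2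
  obtain ⟨w, hw⟩ := h3
  have hb := Int.gcd_eq_gcd_ab i (p : ℤ)
  refine ⟨Int.gcdA i p * w, ?_⟩
  show (a ^ i) ^ (Int.gcdA i p * w) = a ^ j
  rw [← zpow_mul, hw, ← mul_assoc]
  have : (g : ℤ) * w = i * Int.gcdA i p * w + p * (Int.gcdB i p * w) := by
    rw [hg, hb]; ring
  rw [this, zpow_add, zpow_mul a (p : ℤ), zpow_natCast, hp, pow_orderOf_eq_one, one_zpow, mul_one]

theorem TP.card [Finite G] (h : TP a b) : Nat.card G = orderOf a * orderOf b := by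
  rw [← Nat.card_zpowers a, ← Nat.card_zpowers b, ← Nat.card_prod]
  symm
  apply Nat.card_congr
  refine Equiv.ofBijective (fun x : Subgroup.zpowers a × Subgroup.zpowers b => (x.1 : G) * x.2) ⟨?_, ?_⟩
  · rintro ⟨⟨_, i, rfl⟩, ⟨_, j, rfl⟩⟩ ⟨⟨_, x, rfl⟩, ⟨_, y, rfl⟩⟩ e
    obtain ⟨h1, h2⟩ := h.uniq (show a ^ i * b ^ j = a ^ x * b ^ y from e)
    simp [h1, h2]
  · intro g
    obtain ⟨i, j, e⟩ := h.tight g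
    exact ⟨⟨⟨_, i, rfl⟩, ⟨_, j, rfl⟩⟩, e.symm⟩

/-- nontrivial core -/
theorem TP.core_ne [Finite G] (h : TP a b) (hpq : orderOf b ≤ orderOf a) (hp : 2 ≤ orderOf a) :
    (Subgroup.zpowers a).normalCore ≠ ⊥ := by
  -- a power of `a` normalised by `b`
  obtain ⟨i, hi, hn⟩ : ∃ i : ℤ, a ^ i ≠ 1 ∧ b * a ^ i * b⁻¹ ∈ Subgroup.zpowers (a ^ i) := by
    by_cases hb : b = 1
    · refine ⟨1, ?_, ?_⟩
      · rw [zpow_one]; rintro rfl; simp at hp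
      · subst hb; simp
    by_contra! hcon
    have hinj : Function.Injective (fun x : Subgroup.zpowers a × Subgroup.zpowers a =>
        (x.1 : G) * (b * x.2 * b⁻¹)) := by
      rintro ⟨⟨_, i, rfl⟩, ⟨_, j, rfl⟩⟩ ⟨⟨_, x, rfl⟩, ⟨_, y, rfl⟩⟩ e
      have e : a ^ i * (b * a ^ j * b⁻¹) = a ^ x * (b * a ^ y * b⁻¹) := e
      have e1 : b * a ^ (j - y) * b⁻¹ = a ^ (x - i) := by
        have : a ^ (-i) * (a ^ i * (b * a ^ j * b⁻¹)) * (b * a ^ (-y) * b⁻¹) =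
          a ^ (-i) * (a ^ x * (b * a ^ y * b⁻¹)) * (b * a ^ (-y) * b⁻¹) := by rw [e]
        calc b * a ^ (j - y) * b⁻¹ = a ^ (-i) * (a ^ i * (b * a ^ j * b⁻¹)) * (b * a ^ (-y) * b⁻¹) := by
              group
          _ = _ := this
          _ = a ^ (x - i) := by group
      have h1 : a ^ (j - y) = 1 := by
        by_contra hne
        apply hcon _ hne
        rw [e1]
        apply zpow_mem_zp
        rw [← e1]
        exact (orderOf_injective (MulAut.conj b).toMonoidHom (MulAut.conj b).injective _).symm
      have h2 : a ^ (x - i) = 1 := by rw [← e1, h1]; group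
      rw [zpow_sub, mul_inv_eq_one] at h1 h2
      simp [h1, h2]
    have hns : ¬ Function.Surjective (fun x : Subgroup.zpowers a × Subgroup.zpowers a =>
        (x.1 : G) * (b * x.2 * b⁻¹)) := by
      intro hs
      obtain ⟨⟨⟨_, i, rfl⟩, ⟨_, j, rfl⟩⟩, e⟩ := hs b⁻¹
      have e : a ^ i * (b * a ^ j * b⁻¹) = b⁻¹ := e
      have e1 : a ^ (-i - j) = b ^ (1 : ℤ) := by
        have e2 : a ^ i * b * a ^ j = 1 := by
          calc a ^ i * b * a ^ j = a ^ i * (b * a ^ j * b⁻¹) * b := by group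
            _ = 1 := by rw [e]; group
        calc a ^ (-i - j) = a ^ (-i) * 1 * a ^ (-j) := by group
          _ = b ^ (1 : ℤ) := by rw [← e2]; group
      apply hb
      simpa using (h.disj' e1).2
    have h1 : Nat.card (Subgroup.zpowers a × Subgroup.zpowers a) = Nat.card G := by
      apply le_antisymm (Nat.card_le_card_of_injective _ hinj)
      rw [Nat.card_prod, h.card, Nat.card_zpowers]
      exact Nat.mul_le_mul_left _ hpq
    exact hns ((Nat.bijective_iff_injective_and_card _).2 ⟨hinj, h1⟩).2
  have hN : (Subgroup.zpowers (a ^ i)).Normal := by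
    apply h.normal
    · rintro _ ⟨j, rfl⟩
      refine ⟨j, ?_⟩
      show (a ^ i) ^ j = a * (a ^ i) ^ j * a⁻¹
      group
    · rintro _ ⟨j, rfl⟩
      have : b * (a ^ i) ^ j * b⁻¹ = (b * a ^ i * b⁻¹) ^ j := by rw [conj_zpow]
      show b * (a ^ i) ^ j * b⁻¹ ∈ _
      rw [this]
      exact Subgroup.zpow_mem _ hn j
  intro hbot
  have hle : Subgroup.zpowers (a ^ i) ≤ (Subgroup.zpowers a).normalCore :=
    Subgroup.normal_le_normalCore.2 (by
      rw [Subgroup.zpowers_le]; exact ⟨i, rfl⟩)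
  rw [hbot] at hle
  exact hi (by simpa using hle (Subgroup.mem_zpowers (a ^ i)))

theorem TP.quot {K : Subgroup G} [K.Normal] (h : TP a b)
    (hK : ∀ i j : ℤ, a ^ i * b ^ j ∈ K → a ^ i ∈ K) : TP (a : G ⧸ K) (b : G ⧸ K) := by
  refine ⟨?_, ?_, ?_⟩
  · have := congrArg (QuotientGroup.mk' K) h.inv
    simpa using this
  · intro i j e
    rw [← QuotientGroup.mk_zpow, ← QuotientGroup.mk_zpow, QuotientGroup.eq, ← zpow_neg] at e
    have := hK _ _ e
    rw [← QuotientGroup.mk_zpow, QuotientGroup.eq_one_iff]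
    simpa using K.inv_mem this
  · intro g
    induction g using QuotientGroup.induction_on with
    | H g =>
      obtain ⟨i, j, e⟩ := h.tight g
      refine ⟨i, j, ?_⟩
      rw [e]; simp

theorem TP.fact_le (h : TP a b) {K : Subgroup G} (hK : K ≤ Subgroup.zpowers a) (i j : ℤ)
    (e : a ^ i * b ^ j ∈ K) : a ^ i ∈ K := by
  obtain ⟨x, hx⟩ := hK e
  have hx : a ^ x = a ^ i * b ^ j := hx
  have : a ^ x * b ^ (0 : ℤ) = a ^ i * b ^ j := by rw [hx]; simp
  have h2 := (h.uniq this).2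
  rw [zpow_zero] at h2
  rwa [← h2, mul_one] at e

theorem TP.fact_le' (h : TP a b) {K : Subgroup G} (hK : K ≤ Subgroup.zpowers b) (i j : ℤ)
    (e : a ^ i * b ^ j ∈ K) : a ^ i ∈ K := by
  obtain ⟨x, hx⟩ := hK e
  have hx : b ^ x = a ^ i * b ^ j := hx
  have : a ^ (0 : ℤ) * b ^ x = a ^ i * b ^ j := by rw [hx]; simp
  have h2 := (h.uniq this).1
  rw [zpow_zero] at h2
  rw [← h2]; exact K.one_mem

theorem mem_iff_dvd (K : Subgroup G) [K.Normal] (x : G) (i : ℤ) :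
    x ^ i ∈ K ↔ (orderOf (x : G ⧸ K) : ℤ) ∣ i := by
  rw [orderOf_dvd_iff_zpow_eq_one, ← QuotientGroup.mk_zpow, QuotientGroup.eq_one_iff]

theorem TP.order_b (h : TP a b) {K : Subgroup G} [K.Normal] (hK : K ≤ Subgroup.zpowers a) :
    orderOf (b : G ⧸ K) = orderOf b := by
  apply Nat.dvd_antisymm
  · exact orderOf_map_dvd (QuotientGroup.mk' K) b
  · have : b ^ (orderOf (b : G ⧸ K) : ℤ) ∈ K := (mem_iff_dvd K b _).2 dvd_rfl
    obtain ⟨x, hx⟩ := hK this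
    have := (h.disj' hx).2
    rw [zpow_natCast] at this
    exact orderOf_dvd_of_pow_eq_one this

theorem card_quot_lt [Finite G] {K : Subgroup G} [K.Normal] (hK : K ≠ ⊥) :
    Nat.card (G ⧸ K) < Nat.card G := by
  rw [Subgroup.card_eq_card_quotient_mul_card_subgroup K]
  have h1 : 1 < Nat.card K := K.one_lt_card_iff_ne_bot.2 hK
  have : 0 < Nat.card (G ⧸ K) := Nat.card_pos
  nlinarith

end basics
section reg
variable {G : Type*} [Group G] {a b : G}

theorem RegP.of_OR (h : IsOrientablyRegular a b) : RegP a b := by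
  obtain ⟨φ, ha, hb⟩ := h
  intro i x y e
  have := congrArg φ e
  simpa [ha, hb, map_zpow] using this

theorem RegP.toOR [Finite G] (h : TP a b) (hr : RegP a b) : IsOrientablyRegular a b := by
  choose I J hIJ using h.tight
  let φ : G → G := fun g => a ^ (-(I g)) * b ^ (-(J g))
  have hφ : ∀ i j : ℤ, φ (a ^ i * b ^ j) = a ^ (-i) * b ^ (-j) := by
    intro i j
    have := h.uniq (hIJ (a ^ i * b ^ j)).symm
    show a ^ (-(I (a ^ i * b ^ j))) * b ^ (-(J (a ^ i * b ^ j))) = _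
    rw [zpow_neg, zpow_neg, this.1, this.2, zpow_neg, zpow_neg]
  have h1 : φ 1 = 1 := by simpa using hφ 0 0
  have hA : φ a = a⁻¹ := by simpa using hφ 1 0
  have hB : φ b = b⁻¹ := by simpa using hφ 0 1
  have hmul : ∀ g h, φ (g * h) = φ g * φ h := by
    intro g
    refine h.induct
      { carrier := {g | ∀ h, φ (g * h) = φ g * φ h}
        one_mem' := by intro x; simp [h1]
        mul_mem' := by
          intro u v hu hv x
          rw [mul_assoc, hu, hv, hu v]
          exact (mul_assoc _ _ _).symm } ?_ ?_ g
    · intro x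
      obtain ⟨i, j, rfl⟩ := h.tight x
      rw [hA, ← mul_assoc, ← zpow_one_add, hφ, hφ]
      group
    · intro x
      obtain ⟨i, j, rfl⟩ := h.tight x
      obtain ⟨u, v, e⟩ := h.tight (b * a ^ i)
      have := hr i u v e
      rw [hB, ← mul_assoc, e, hφ, mul_assoc, ← zpow_add, hφ, ← mul_assoc, this, mul_assoc,
        ← zpow_add]
      congr 2
      ring
  let f : G →* G := ⟨⟨φ, h1⟩, hmul⟩
  have hs : Function.Surjective f := by
    intro g
    obtain ⟨i, j, rfl⟩ := h.tight g
    refine ⟨a ^ (-i) * b ^ (-j), ?_⟩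
    show φ _ = _
    rw [hφ]; simp
  exact ⟨MulEquiv.ofBijective f (Finite.surjective_iff_bijective.1 hs), hA, hB⟩

theorem RegMod.of_OR {H : Type*} [Group H] (f : G →* H) (h : IsOrientablyRegular (f a) (f b)) :
    RegMod a b f := by
  intro i x y e
  have := RegP.of_OR h i x y (by simpa using congrArg f e)
  simpa using this

theorem RegMod.of_comm {H : Type*} [Group H] (f : G →* H) (hc : ∀ x y : G, f x * f y = f y * f x) :
    RegMod a b f := by
  intro i x y e
  have e := congrArg f e
  simp only [map_mul, map_zpow, map_inv] at e ⊢
  have e2 := congrArg Inv.inv e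
  simp only [mul_inv_rev] at e2
  have c1 : Commute (f b)⁻¹ (f a ^ (-i)) := ((show Commute (f b) (f a) from hc b a).inv_left).zpow_right _
  have c2 : Commute (f a ^ (-x)) (f b ^ (-y)) := ((show Commute (f a) (f b) from hc a b).zpow_left _).zpow_right _
  rw [c1.eq, c2.eq, zpow_neg, zpow_neg, zpow_neg]
  exact e2

theorem RegP.of_two {H H' : Type*} [Group H] [Group H'] (f : G →* H) (g : G →* H')
    (hf : RegMod a b f) (hg : RegMod a b g) (hk : ∀ x, f x = 1 → g x = 1 → x = 1) :
    RegP a b := by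
  intro i x y e
  have e1 := hf i x y e
  have e2 := hg i x y e
  rw [← mul_inv_eq_one]
  apply hk
  · rw [map_mul, map_inv, e1, mul_inv_cancel]
  · rw [map_mul, map_inv, e2, mul_inv_cancel]

theorem OR_symm (h : IsOrientablyRegular a b) : IsOrientablyRegular b a := by
  obtain ⟨φ, h1, h2⟩ := h
  exact ⟨φ, h2, h1⟩

/-- `b^2` centralises normal subgroups inside `⟨a⟩`. -/
theorem TP.cent (h : TP a b) {N : Subgroup G} [hN : N.Normal] (hNa : N ≤ Subgroup.zpowers a)
    {n : G} (hn : n ∈ N) : b ^ 2 * n = n * b ^ 2 := by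
  have ca : ∀ n ∈ N, a * n = n * a := by
    intro n hn
    obtain ⟨i, rfl⟩ := hNa hn
    exact ((Commute.refl a).zpow_right i).eq
  have h1 : b * n * b⁻¹ ∈ N := hN.conj_mem n hn b
  have e1 := ca _ h1
  have e2 := h.rel
  have h2 : b * (b * n * b⁻¹) * b⁻¹ ∈ N := hN.conj_mem _ h1 b
  have e3 := ca _ h2
  have e4 := h.inv
  rw [pow_two] at e4
  -- conjugating `n` twice by `ab`
  have e5 : b * (b * n * b⁻¹) * b⁻¹ = n := by
    calc b * (b * n * b⁻¹) * b⁻¹ = a * (b * (b * n * b⁻¹) * b⁻¹) * a⁻¹ := by rw [e3]; group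
      _ = a * (b * (a * (b * n * b⁻¹) * a⁻¹) * b⁻¹) * a⁻¹ := by
          rw [show a * (b * n * b⁻¹) * a⁻¹ = b * n * b⁻¹ by rw [e1]; group]
      _ = (a * b * (a * b)) * n * (a * b * (a * b))⁻¹ := by group
      _ = n := by rw [e4]; group
  calc b ^ 2 * n = (b * (b * n * b⁻¹) * b⁻¹) * b ^ 2 := by simp [pow_two, mul_assoc]
    _ = n * b ^ 2 := by rw [e5]

/-- `a^2` in a normal subgroup of `⟨a⟩` implies regularity -/
theorem TP.reg_of_sq (h : TP a b) {l : ℤ} (hl : b * a ^ 2 * b⁻¹ = a ^ (2 * l))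
    (hc : b ^ 2 * a ^ 2 = a ^ 2 * b ^ 2) : RegP a b := by
  have hl2 : b⁻¹ * a ^ 2 * b = a ^ (2 * l) := by
    rw [← hl]
    calc b⁻¹ * a ^ 2 * b = b⁻¹ * (a ^ 2 * b ^ 2) * b⁻¹ := by group
      _ = _ := by rw [← hc]; group
  have k1 : ∀ j : ℤ, b * a ^ (2 * j) * b⁻¹ = a ^ (2 * l * j) := by
    intro j
    rw [zpow_mul a (2 * l), ← hl, conj_zpow, zpow_mul]; norm_cast
  have k2 : ∀ j : ℤ, b⁻¹ * a ^ (2 * j) * b = a ^ (2 * l * j) := by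
    intro j
    rw [zpow_mul a (2 * l), ← hl2]
    have := conj_zpow (a := b⁻¹) (b := a ^ 2) (i := j)
    rw [inv_inv] at this
    rw [this, zpow_mul]; norm_cast
  have r1 := h.rel
  have r2 : b⁻¹ * a⁻¹ = a * b := by
    have := h.inv
    rw [pow_two] at this
    rw [← mul_inv_rev]
    exact (eq_inv_of_mul_eq_one_left this).symm
  intro i x y e
  rcases Int.even_or_odd' i with ⟨j, rfl | rfl⟩
  · have e1 : a ^ (2 * l * j) * b ^ (1 : ℤ) = a ^ x * b ^ y := by
      rw [← e, ← k1]; group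
    obtain ⟨u, v⟩ := h.uniq e1
    rw [zpow_neg a x, zpow_neg b y, ← u, ← v, ← zpow_neg]
    have := k2 (-j)
    calc b⁻¹ * a ^ (-(2 * j)) = b⁻¹ * a ^ (2 * (-j)) * b * b⁻¹ := by group
      _ = a ^ (-(2 * l * j)) * (b ^ (1 : ℤ))⁻¹ := by rw [this]; group
  · have e1 : a ^ (2 * l * j - 1) * b ^ (-1 : ℤ) = a ^ x * b ^ y := by
      rw [← e]
      calc a ^ (2 * l * j - 1) * b ^ (-1 : ℤ) = a ^ (2 * l * j) * (a⁻¹ * b⁻¹) := by group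
        _ = b * a ^ (2 * j) * b⁻¹ * (b * a) := by rw [k1, r1]
        _ = _ := by group
    obtain ⟨u, v⟩ := h.uniq e1
    rw [zpow_neg a x, zpow_neg b y, ← u, ← v]
    have := k2 (-j)
    calc b⁻¹ * a ^ (-(2 * j + 1)) = (b⁻¹ * a ^ (2 * (-j)) * b) * (b⁻¹ * a⁻¹) := by group
      _ = _ := by rw [this, r2]; group

/-- the core of `⟨a⟩`, as a subgroup -/
abbrev coreA (a : G) : Subgroup G := (Subgroup.zpowers a).normalCore

theorem zpowers_normal_of_core {a : G} [Finite G] {N : Subgroup G} [hN : N.Normal] (hNa : N ≤ Subgroup.zpowers a) {d : G}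
    (hd : d ∈ N) : (Subgroup.zpowers d).Normal := by
  constructor
  rintro _ ⟨j, rfl⟩ g
  have h1 : g * d * g⁻¹ ∈ N := hN.conj_mem d hd g
  obtain ⟨i, rfl⟩ := hNa hd
  obtain ⟨x, hx⟩ := hNa h1
  have hx : a ^ x = g * a ^ i * g⁻¹ := hx
  have h2 : a ^ x ∈ Subgroup.zpowers (a ^ i) := by
    apply zpow_mem_zp
    rw [hx]
    exact (orderOf_injective (MulAut.conj g).toMonoidHom (MulAut.conj g).injective _).symm
  show g * (a ^ i) ^ j * g⁻¹ ∈ _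
  rw [← conj_zpow, ← hx]
  exact Subgroup.zpow_mem _ h2 j

theorem TP.core_quot [Finite G] (h : TP a b) :
    orderOf (a : G ⧸ coreA a) < orderOf b ∨ orderOf (a : G ⧸ coreA a) = 1 := by
  by_contra! hcon
  obtain ⟨h1, h2⟩ := hcon
  have hle := Subgroup.normalCore_le (Subgroup.zpowers a)
  have hq := h.quot (K := coreA a) (h.fact_le hle)
  have h0 : 0 < orderOf (a : G ⧸ coreA a) := orderOf_pos _
  have hne := hq.core_ne (by rw [h.order_b hle]; exact h1) (by omega)
  apply hne
  rw [eq_bot_iff]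
  -- pull back
  set C := coreA (a : G ⧸ coreA a)
  have hN : (C.comap (QuotientGroup.mk' (coreA a))).Normal := inferInstance
  have hl : C.comap (QuotientGroup.mk' (coreA a)) ≤ coreA a := by
    apply Subgroup.normal_le_normalCore.2
    intro x hx
    have hx : (x : G ⧸ coreA a) ∈ C := hx
    obtain ⟨i, hi⟩ := Subgroup.normalCore_le _ hx
    have hi : (a : G ⧸ coreA a) ^ i = x := hi
    rw [← QuotientGroup.mk_zpow, QuotientGroup.eq] at hi
    have := Subgroup.mul_mem _ (show a ^ i ∈ Subgroup.zpowers a from ⟨i, rfl⟩) (hle hi)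
    simpa using this
  intro x hx
  induction x using QuotientGroup.induction_on with
  | H x =>
    have := hl (show x ∈ C.comap (QuotientGroup.mk' (coreA a)) from hx)
    rw [Subgroup.mem_bot, QuotientGroup.eq_one_iff]
    exact this

end reg
/-- product of two commuting cyclic subgroups -/
def prodSub {G : Type*} [Group G] (d m : G) (hc : Commute d m) : Subgroup G where
  carrier := {x | ∃ u v : ℤ, x = d ^ u * m ^ v}
  one_mem' := ⟨0, 0, by simp⟩
  mul_mem' := by
    rintro _ _ ⟨u, v, rfl⟩ ⟨u', v', rfl⟩
    refine ⟨u + u', v + v', ?_⟩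
    have := (hc.zpow_zpow u' v).eq
    rw [zpow_add, zpow_add]
    calc d ^ u * m ^ v * (d ^ u' * m ^ v') = d ^ u * (m ^ v * d ^ u') * m ^ v' := by group
      _ = _ := by rw [← this]; group
  inv_mem' := by
    rintro _ ⟨u, v, rfl⟩
    refine ⟨-u, -v, ?_⟩
    rw [(hc.zpow_zpow u v).eq]
    group

theorem exists_conj {G : Type*} [Group G] [Finite G] {a : G} (N : Subgroup G) [N.Normal] {x g : G}
    (hx : ((x : G) : G ⧸ N) ∈ coreA (a : G ⧸ N)) :
    ∃ (l : ℤ) (n : G), n ∈ N ∧ g * x * g⁻¹ = x ^ l * n := by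
  have h1 := zpowers_normal_of_core (Subgroup.normalCore_le _) hx
  obtain ⟨l, hl⟩ := h1.conj_mem _ (Subgroup.mem_zpowers _) (g : G ⧸ N)
  have hl : (x : G ⧸ N) ^ l = g * x * (g : G ⧸ N)⁻¹ := hl
  refine ⟨l, (x ^ l)⁻¹ * (g * x * g⁻¹), ?_, by group⟩
  rw [← QuotientGroup.eq]
  simpa using hl

theorem parity : ∀ (n : ℕ) (G : Type) [Group G] [Finite G] (a b : G), Nat.card G = n → TP a b →
    Odd (orderOf a) → orderOf b ∣ 2 * orderOf a := by
  intro n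
  induction n using Nat.strong_induction_on with
  | _ n ih =>
  intro G _ _ a b hn h hodd
  by_cases hN : coreA a = ⊥
  swap
  · have hle := Subgroup.normalCore_le (Subgroup.zpowers a)
    have hq := h.quot (K := coreA a) (h.fact_le hle)
    have hd : orderOf (a : G ⧸ coreA a) ∣ orderOf a := orderOf_map_dvd (QuotientGroup.mk' _) a
    have := ih _ (hn ▸ card_quot_lt hN) _ _ _ rfl hq (hodd.of_dvd_nat hd)
    rw [h.order_b hle] at this
    exact this.trans (Nat.mul_dvd_mul_left 2 hd)
  by_cases hp1 : orderOf a = 1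
  · have ha : a = 1 := orderOf_eq_one_iff.1 hp1
    have := h.inv
    rw [hp1, mul_one]
    apply orderOf_dvd_of_pow_eq_one
    simpa [ha] using this
  have hp0 : 0 < orderOf a := orderOf_pos a
  have hlt : orderOf a < orderOf b := by
    by_contra hcon
    exact h.core_ne (by omega) (by omega) hN
  have hM : coreA b ≠ ⊥ := h.symm.core_ne (by omega) (by omega)
  have hle := Subgroup.normalCore_le (Subgroup.zpowers b)
  have hq := h.quot (K := coreA b) (h.fact_le' hle)
  have hoa : orderOf (a : G ⧸ coreA b) = orderOf a := h.symm.order_b hle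
  have hs := h.symm.core_quot
  have hne : coreA (a : G ⧸ coreA b) ≠ ⊥ := hq.core_ne (by omega) (by omega)
  obtain ⟨y, hy, hy1⟩ := (show ∃ y, y ∈ coreA (a : G ⧸ coreA b) ∧ y ≠ 1 by
    obtain ⟨y, hy⟩ := Subgroup.ne_bot_iff_exists_ne_one.1 hne
    exact ⟨y.1, y.2, fun e => hy (Subtype.ext e)⟩)
  obtain ⟨i, hi⟩ := Subgroup.normalCore_le _ hy
  have hi : (a : G ⧸ coreA b) ^ i = y := hi
  rw [← QuotientGroup.mk_zpow] at hi
  subst hi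
  obtain ⟨l, m, hm, hl⟩ := exists_conj (coreA b) (g := b) hy
  -- m is central
  have hmb : Commute b m := by
    obtain ⟨j, rfl⟩ := hle hm
    exact (Commute.refl b).zpow_right j
  have hma : Commute a m := by
    have h2 : Commute (a ^ 2) m := h.symm.cent hle hm
    obtain ⟨k, hk⟩ := hodd
    have : a = (a ^ 2) ^ (k + 1) := by
      have e : 2 * (k + 1) = orderOf a + 1 := by omega
      rw [← pow_mul, e, pow_succ, pow_orderOf_eq_one, one_mul]
    rw [this]
    exact h2.pow_left _
  have hdm : Commute (a ^ i) m := hma.zpow_left i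
  let K := prodSub (a ^ i) m hdm
  have hdK : a ^ i ∈ K := ⟨1, 0, by simp⟩
  have hKn : K.Normal := by
    apply h.normal
    · rintro _ ⟨u, v, rfl⟩
      refine ⟨u, v, ?_⟩
      have := (hma.zpow_right v).eq
      calc a * ((a ^ i) ^ u * m ^ v) * a⁻¹ = (a ^ i) ^ u * (a * m ^ v) * a⁻¹ := by group
        _ = _ := by rw [this]; group
    · rintro _ ⟨u, v, rfl⟩
      have := (hmb.zpow_right v).eq
      have e : b * ((a ^ i) ^ u * m ^ v) * b⁻¹ = (b * a ^ i * b⁻¹) ^ u * m ^ v := by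
        rw [conj_zpow]
        calc b * ((a ^ i) ^ u * m ^ v) * b⁻¹ = b * (a ^ i) ^ u * b⁻¹ * (b * m ^ v) * b⁻¹ := by group
          _ = _ := by rw [this]; group
      rw [e]
      apply K.mul_mem
      · apply K.zpow_mem
        rw [hl]
        exact ⟨l, 1, by simp⟩
      · exact ⟨0, v, by simp⟩
  obtain ⟨j, hj⟩ := hle hm
  have hj : b ^ j = m := hj
  have hsplit : ∀ x y : ℤ, a ^ x * b ^ y ∈ K → (∃ u : ℤ, a ^ x = (a ^ i) ^ u) ∧ ∃ v : ℤ, b ^ y = m ^ v := by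
    rintro x y ⟨u, v, e⟩
    rw [← hj, ← zpow_mul, ← zpow_mul] at e
    obtain ⟨e1, e2⟩ := h.uniq e
    exact ⟨⟨u, by rw [e1, zpow_mul]⟩, ⟨v, by rw [e2, ← hj, zpow_mul]⟩⟩
  have hfac : ∀ x y : ℤ, a ^ x * b ^ y ∈ K → a ^ x ∈ K := by
    intro x y hxy
    obtain ⟨⟨u, hu⟩, _⟩ := hsplit x y hxy
    exact ⟨u, 0, by simpa using hu⟩
  have hKq := h.quot (K := K) hfac
  have hKb : K ≠ ⊥ := by
    intro hb
    rw [hb, Subgroup.mem_bot] at hdK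
    apply hy1
    rw [hdK]; rfl
  have hd : orderOf (a : G ⧸ K) ∣ orderOf a := orderOf_map_dvd (QuotientGroup.mk' _) a
  have hI := ih _ (hn ▸ card_quot_lt hKb) _ _ _ rfl hKq (hodd.of_dvd_nat hd)
  set o := orderOf (a ^ i) with ho
  have hmo : m ^ o = 1 := by
    have e1 : (b * a ^ i * b⁻¹) ^ o = 1 := by
      rw [conj_pow, ho, pow_orderOf_eq_one]; group
    rw [hl, (hdm.zpow_left l).mul_pow, ← zpow_natCast, ← zpow_mul, mul_comm, zpow_mul, zpow_natCast,
      ho, pow_orderOf_eq_one, one_zpow, one_mul] at e1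
    exact e1
  have hq1 : orderOf b ∣ orderOf (b : G ⧸ K) * o := by
    apply orderOf_dvd_of_pow_eq_one
    have : b ^ (orderOf (b : G ⧸ K) : ℤ) ∈ K := (mem_iff_dvd K b _).2 dvd_rfl
    obtain ⟨_, v, hv⟩ := hsplit 0 (orderOf (b : G ⧸ K) : ℤ) (by rw [zpow_zero, one_mul]; exact this)
    rw [pow_mul, ← zpow_natCast b, hv, ← zpow_natCast, ← zpow_mul, mul_comm, zpow_mul, zpow_natCast,
      hmo, one_zpow]
  have hp2 : orderOf (a : G ⧸ K) * o ∣ orderOf a := by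
    have hg : a ^ (Int.gcd i (orderOf a) : ℤ) ∈ K := by
      rw [Int.gcd_eq_gcd_ab]
      refine ⟨Int.gcdA i (orderOf a), 0, ?_⟩
      rw [zpow_add, zpow_mul a (orderOf a : ℤ), zpow_natCast, pow_orderOf_eq_one, one_zpow, zpow_mul]
      simp
    rw [mem_iff_dvd] at hg
    have hg : orderOf (a : G ⧸ K) ∣ Int.gcd i (orderOf a) := by exact_mod_cast hg
    obtain ⟨u, hu⟩ : Int.gcd i (orderOf a) ∣ orderOf a := by
      have := Int.gcd_dvd_right i (orderOf a : ℤ); exact_mod_cast this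
    have h1 : o ∣ u := by
      apply orderOf_dvd_of_pow_eq_one
      obtain ⟨v, hv⟩ := Int.gcd_dvd_left i (orderOf a : ℤ)
      rw [← zpow_natCast, ← zpow_mul, ← orderOf_dvd_iff_zpow_eq_one]
      refine ⟨v, ?_⟩
      calc i * u = (Int.gcd i (orderOf a) * v) * u := by rw [← hv]
        _ = ((Int.gcd i (orderOf a) * u : ℕ) : ℤ) * v := by push_cast; ring
        _ = _ := by rw [← hu]
    calc orderOf (a : G ⧸ K) * o ∣ Int.gcd i (orderOf a) * u := Nat.mul_dvd_mul hg h1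
      _ = orderOf a := hu.symm
  calc orderOf b ∣ orderOf (b : G ⧸ K) * o := hq1
    _ ∣ 2 * orderOf (a : G ⧸ K) * o := Nat.mul_dvd_mul_right hI o
    _ = 2 * (orderOf (a : G ⧸ K) * o) := by ring
    _ ∣ _ := Nat.mul_dvd_mul_left 2 hp2

/-- normal `2`-complement -/
theorem two_compl : ∀ (n : ℕ) (G : Type) [Group G] [Finite G] (a b : G), Nat.card G = n → TP a b →
    ∃ O : Subgroup G, ∃ _ : O.Normal, Odd (Nat.card O) ∧ IsPGroup 2 (G ⧸ O) := by
  intro n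
  induction n using Nat.strong_induction_on with
  | _ n ih =>
  intro G _ _ a b hn h
  -- a normal subgroup of prime order with tight quotient
  by_cases htriv : orderOf a = 1 ∧ orderOf b = 1
  · refine ⟨⊤, inferInstance, ?_, ?_⟩
    · rw [Subgroup.card_top, h.card, htriv.1, htriv.2]; decide
    · intro g
      refine ⟨0, ?_⟩
      induction g using QuotientGroup.induction_on with
      | H g => simp [QuotientGroup.eq_one_iff]
  obtain ⟨R, hRn, r, hr, hRc, hRq⟩ : ∃ R : Subgroup G, ∃ _ : R.Normal, ∃ r : ℕ, r.Prime ∧ Nat.card R = r ∧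
      TP (a : G ⧸ R) (b : G ⧸ R) := by
    have gen : ∀ x : G, coreA x ≠ ⊥ → ∃ R : Subgroup G, ∃ _ : R.Normal, ∃ r : ℕ, r.Prime ∧
        Nat.card R = r ∧ R ≤ Subgroup.zpowers x := by
      intro x hx
      have hle := Subgroup.normalCore_le (Subgroup.zpowers x)
      have h1 : 1 < Nat.card (coreA x) := Subgroup.one_lt_card_iff_ne_bot _ |>.2 hx
      obtain ⟨r, hr, hrd⟩ := Nat.exists_prime_and_dvd h1.ne'
      have := Fact.mk hr
      obtain ⟨y, hy⟩ := exists_prime_orderOf_dvd_card' (G := coreA x) r hrd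
      refine ⟨Subgroup.zpowers (y : G), zpowers_normal_of_core hle y.2, r, hr, ?_, ?_⟩
      · rw [Nat.card_zpowers, Subgroup.orderOf_coe, hy]
      · rw [Subgroup.zpowers_le]; exact hle y.2
    have h0 : 0 < orderOf a := orderOf_pos a
    have h0' : 0 < orderOf b := orderOf_pos b
    rcases le_total (orderOf b) (orderOf a) with hab | hab
    · obtain ⟨R, hR, r, hr, hc, hl⟩ := gen a (h.core_ne hab (by omega))
      exact ⟨R, hR, r, hr, hc, h.quot (h.fact_le hl)⟩
    · obtain ⟨R, hR, r, hr, hc, hl⟩ := gen b (h.symm.core_ne hab (by omega))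
      exact ⟨R, hR, r, hr, hc, h.quot (h.fact_le' hl)⟩
  have hRb : R ≠ ⊥ := by
    rintro rfl
    rw [Subgroup.card_bot] at hRc
    exact hr.one_lt.ne hRc
  obtain ⟨O', hO'n, hodd, hp2⟩ := ih _ (hn ▸ card_quot_lt hRb) _ _ _ rfl hRq
  set n' := Nat.card O' with hn'
  let O1 : Subgroup G := O'.comap (QuotientGroup.mk' R)
  have hO1n : O1.Normal := inferInstance
  have hRO : R ≤ O1 := by
    intro x hx
    show (QuotientGroup.mk' R) x ∈ O'
    rw [(QuotientGroup.eq_one_iff x).2 hx |> fun e => (show (QuotientGroup.mk' R) x = 1 from e)]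
    exact O'.one_mem
  have hc1 : Nat.card O1 = n' * r := by
    have e1 : O1.index = O'.index :=
      Subgroup.index_comap_of_surjective O' (QuotientGroup.mk'_surjective R)
    have e2 := Subgroup.index_mul_card O1
    have e3 := Subgroup.index_mul_card O'
    have e4 := Subgroup.card_eq_card_quotient_mul_card_subgroup R
    rw [e4, ← e3, e1, hRc, mul_assoc] at e2
    exact Nat.eq_of_mul_eq_mul_left (Nat.pos_of_ne_zero Subgroup.FiniteIndex.index_ne_zero) e2
  have hpow : ∀ x ∈ O1, x ^ n' ∈ R := by
    intro x hx
    have hx : (x : G ⧸ R) ∈ O' := hx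
    have := pow_card_eq_one' (x := (⟨_, hx⟩ : O'))
    rw [← QuotientGroup.eq_one_iff]
    exact congrArg Subtype.val this
  have hind : ∀ g : G, ∃ k : ℕ, g ^ 2 ^ k ∈ O1 := by
    intro g
    obtain ⟨k, hk⟩ := hp2 ((g : G ⧸ R) : (G ⧸ R) ⧸ O')
    refine ⟨k, ?_⟩
    rw [← QuotientGroup.mk_pow, QuotientGroup.eq_one_iff, ← QuotientGroup.mk_pow] at hk
    exact hk
  rcases hr.eq_two_or_odd' with rfl | hrodd
  swap
  · refine ⟨O1, hO1n, ?_, ?_⟩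
    · rw [hc1]; exact hodd.mul hrodd
    · intro g
      induction g using QuotientGroup.induction_on with
      | H g =>
        obtain ⟨k, hk⟩ := hind g
        refine ⟨k, ?_⟩
        rw [← QuotientGroup.mk_pow, QuotientGroup.eq_one_iff]
        exact hk
  -- order two: central in O1
  have hcent : ∀ x ∈ R, ∀ g : G, g * x = x * g := by
    intro x hx g
    obtain ⟨u, v, huv, hu⟩ := Nat.card_eq_two_iff.1 hRc
    have hall : ∀ w : R, w = u ∨ w = v := by
      intro w
      have : w ∈ ({u, v} : Set R) := hu ▸ Set.mem_univ w
      simpa using this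
    by_cases hx1 : x = 1
    · simp [hx1]
    have hg : g * x * g⁻¹ ∈ R := hRn.conj_mem x hx g
    have hg1 : g * x * g⁻¹ ≠ 1 := by
      intro e
      apply hx1
      have : x = g⁻¹ * (g * x * g⁻¹) * g := by group
      rw [this, e]; group
    have key : (⟨g * x * g⁻¹, hg⟩ : R) = ⟨x, hx⟩ := by
      have h1 : (⟨g * x * g⁻¹, hg⟩ : R) ≠ 1 := fun e => hg1 (congrArg Subtype.val e)
      have h2 : (⟨x, hx⟩ : R) ≠ 1 := fun e => hx1 (congrArg Subtype.val e)
      rcases hall ⟨g * x * g⁻¹, hg⟩ with e1 | e1 <;> rcases hall ⟨x, hx⟩ with e2 | e2 <;>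
        rcases hall 1 with e3 | e3 <;> first | exact e1.trans e2.symm | exact absurd (e1.trans e3.symm) h1 | exact absurd (e2.trans e3.symm) h2
    have := congrArg Subtype.val key
    exact mul_inv_eq_iff_eq_mul.1 this
  have hhom : ∀ x ∈ O1, ∀ y ∈ O1, (x * y) ^ n' = x ^ n' * y ^ n' := by
    intro x hx y hy
    have hRc' : R.subgroupOf O1 ≤ Subgroup.center O1 := by
      intro z hz
      rw [Subgroup.mem_center_iff]
      intro g
      ext
      exact hcent z hz g
    have hidx : (Subgroup.center O1).index ∣ n' := by
      have h1 := Subgroup.index_dvd_of_le hRc'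
      have h2 : (R.subgroupOf O1).index = n' := by
        have := Subgroup.index_mul_card (R.subgroupOf O1)
        rw [hc1, Nat.card_congr (Subgroup.subgroupOfEquivOfLe hRO).toEquiv, hRc] at this
        exact Nat.eq_of_mul_eq_mul_right (by norm_num) this
      rwa [h2] at h1
    obtain ⟨t, ht⟩ := hidx
    let f := MonoidHom.transferCenterPow O1
    have hf : ∀ x : O1, ((f x ^ t : Subgroup.center O1) : O1) = x ^ n' := by
      intro x
      rw [ht, pow_mul]
      rw [← MonoidHom.transferCenterPow_apply]; rfl
    have e : (f (⟨x, hx⟩ * ⟨y, hy⟩)) ^ t = f ⟨x, hx⟩ ^ t * f ⟨y, hy⟩ ^ t := by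
      rw [map_mul]
      exact Commute.mul_pow (Subtype.ext (Subgroup.mem_center_iff.1 (f ⟨y, hy⟩).2 _)) t
    have e2 := congrArg (Subtype.val) e
    rw [hf, Subgroup.coe_mul, hf, hf] at e2
    exact congrArg Subtype.val e2
  have hRsq : ∀ x ∈ R, x ^ 2 = 1 := by
    intro x hx
    have := pow_card_eq_one' (x := (⟨x, hx⟩ : R))
    rw [hRc] at this
    exact congrArg Subtype.val this
  let O : Subgroup G :=
    { carrier := {x | x ∈ O1 ∧ x ^ n' = 1}
      one_mem' := ⟨O1.one_mem, one_pow _⟩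
      mul_mem' := by
        rintro x y ⟨hx, hx'⟩ ⟨hy, hy'⟩
        exact ⟨O1.mul_mem hx hy, by rw [hhom x hx y hy, hx', hy', one_mul]⟩
      inv_mem' := by
        rintro x ⟨hx, hx'⟩
        exact ⟨O1.inv_mem hx, by rw [inv_pow, hx', inv_one]⟩ }
  have hOn : O.Normal := by
    constructor
    rintro x ⟨hx, hx'⟩ g
    exact ⟨hO1n.conj_mem x hx g, by rw [conj_pow, hx']; group⟩
  refine ⟨O, hOn, ?_, ?_⟩
  · rw [← Nat.not_even_iff_odd, even_iff_two_dvd]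
    intro h2
    obtain ⟨y, hy⟩ := exists_prime_orderOf_dvd_card' (G := O) 2 h2
    have : orderOf y ∣ n' := orderOf_dvd_of_pow_eq_one (by ext; exact y.2.2)
    rw [hy] at this
    exact (Nat.not_even_iff_odd.2 hodd) (even_iff_two_dvd.2 this)
  · intro g
    induction g using QuotientGroup.induction_on with
    | H g =>
      obtain ⟨k, hk⟩ := hind g
      refine ⟨k + 1, ?_⟩
      rw [← QuotientGroup.mk_pow, QuotientGroup.eq_one_iff, pow_succ, pow_mul]
      refine ⟨O1.pow_mem hk 2, ?_⟩
      rw [← pow_mul, mul_comm, pow_mul]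
      exact hRsq _ (hpow _ hk)
section step
variable {G : Type} [Group G] [Finite G] {a b : G}

theorem TP.conj_rel (h : TP a b) {c d : G} {μ ν l : ℤ} (hbc : Commute b c) (hcd : Commute c d)
    (had : Commute a d) (h1 : a * c * a⁻¹ = c ^ μ * d ^ ν) (h2 : b * d * b⁻¹ = d ^ l) :
    c = c ^ (μ * μ) * d ^ (ν * (μ + l)) := by
  have e1 : b * (a * c * a⁻¹) * b⁻¹ = a⁻¹ * c * a := by
    have hb2 : (b ^ 2)⁻¹ * c * b ^ 2 = c := by
      have := (hbc.pow_left 2).eq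
      rw [mul_assoc, ← this]; group
    calc b * (a * c * a⁻¹) * b⁻¹ = (b * a * b⁻¹) * (b * c * b⁻¹) * (b * a * b⁻¹)⁻¹ := by group
      _ = (b * a * b⁻¹) * c * (b * a * b⁻¹)⁻¹ := by rw [hbc.eq]; group
      _ = a⁻¹ * ((b ^ 2)⁻¹ * c * b ^ 2) * a := by rw [h.rel']; group
      _ = _ := by rw [hb2]
  have e2 : b * (c ^ μ * d ^ ν) * b⁻¹ = c ^ μ * d ^ (l * ν) := by
    have := (hbc.zpow_right μ).eq
    calc b * (c ^ μ * d ^ ν) * b⁻¹ = (b * c ^ μ) * d ^ ν * b⁻¹ := by group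
      _ = c ^ μ * (b * d * b⁻¹) ^ ν := by rw [this, conj_zpow]; group
      _ = _ := by rw [h2, zpow_mul]
  rw [h1, e2] at e1
  have e3 : a * (c ^ μ * d ^ (l * ν)) * a⁻¹ = c := by rw [e1]; group
  have e4 : a * (c ^ μ * d ^ (l * ν)) * a⁻¹ = (a * c * a⁻¹) ^ μ * d ^ (l * ν) := by
    have := (had.zpow_right (l * ν)).eq
    calc a * (c ^ μ * d ^ (l * ν)) * a⁻¹ = a * c ^ μ * a⁻¹ * (a * d ^ (l * ν)) * a⁻¹ := by group
      _ = _ := by rw [this, conj_zpow]; group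
  rw [e4, h1, (hcd.zpow_zpow μ ν).mul_zpow] at e3
  rw [← zpow_mul, ← zpow_mul, mul_assoc, ← zpow_add] at e3
  rw [show ν * (μ + l) = ν * μ + l * ν by ring]
  exact e3.symm

/-- a subgroup of `⟨b⟩` normalised by `a` is normal, so trivial if the core is -/
theorem TP.core_triv (h : TP a b) (hB : coreA b = ⊥) {c : G} (hc : c ∈ Subgroup.zpowers b)
    {μ : ℤ} (h1 : a * c * a⁻¹ = c ^ μ) : c = 1 := by
  have hn : (Subgroup.zpowers c).Normal := by
    apply h.normal
    · rintro _ ⟨u, rfl⟩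
      refine ⟨μ * u, ?_⟩
      show c ^ (μ * u) = a * c ^ u * a⁻¹
      rw [← conj_zpow, h1, zpow_mul]
    · rintro _ ⟨u, rfl⟩
      refine ⟨u, ?_⟩
      show c ^ u = b * c ^ u * b⁻¹
      obtain ⟨j, rfl⟩ := hc
      show (b ^ j) ^ u = b * (b ^ j) ^ u * b⁻¹
      group
  have : Subgroup.zpowers c ≤ coreA b :=
    Subgroup.normal_le_normalCore.2 (by rwa [Subgroup.zpowers_le])
  rw [hB] at this
  exact this (Subgroup.mem_zpowers c)

theorem TP.case_two (h : TP a b) (ha : orderOf a = 16) (hb : orderOf b = 8)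
    (hk : orderOf (a : G ⧸ coreA a) = 4) (hB : coreA b = ⊥) : False := by
  have hle := Subgroup.normalCore_le (Subgroup.zpowers a)
  have hq := h.quot (K := coreA a) (h.fact_le hle)
  have hob : orderOf (b : G ⧸ coreA a) = 8 := by rw [h.order_b hle, hb]
  have hs := hq.symm.core_quot
  rw [hk] at hs
  have hsd : orderOf ((b : G ⧸ coreA a) : (G ⧸ coreA a) ⧸ coreA (b : G ⧸ coreA a)) ∣ 8 :=
    hob ▸ orderOf_map_dvd (QuotientGroup.mk' _) _
  have hs2 : orderOf ((b : G ⧸ coreA a) : (G ⧸ coreA a) ⧸ coreA (b : G ⧸ coreA a)) ∣ 2 := by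
    generalize orderOf ((b : G ⧸ coreA a) : (G ⧸ coreA a) ⧸ coreA (b : G ⧸ coreA a)) = s at *
    have : s < 4 := by omega
    interval_cases s <;> omega
  have hmem : ((b ^ 2 : G) : G ⧸ coreA a) ∈ coreA (b : G ⧸ coreA a) := by
    have := (mem_iff_dvd (coreA (b : G ⧸ coreA a)) (b : G ⧸ coreA a) 2).2 (by exact_mod_cast hs2)
    exact_mod_cast this
  obtain ⟨μ, n, hn, hconj⟩ := exists_conj (coreA a) (g := a) hmem
  set c := b ^ 2 with hc
  set d := a ^ 4 with hd
  have hdN : d ∈ coreA a := by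
    have := (mem_iff_dvd (coreA a) a 4).2 (by rw [hk]; norm_num)
    exact_mod_cast this
  obtain ⟨ν, hν⟩ : ∃ ν : ℤ, n = d ^ ν := by
    obtain ⟨i, hi⟩ := hle hn
    have hi : a ^ i = n := hi
    rw [← hi, mem_iff_dvd, hk] at hn
    obtain ⟨ν, rfl⟩ := hn
    exact ⟨ν, by rw [← hi, zpow_mul, hd]; norm_cast⟩
  rw [hν] at hconj
  have hdn := zpowers_normal_of_core hle hdN
  obtain ⟨l, hl⟩ := hdn.conj_mem d (Subgroup.mem_zpowers d) b
  have hl : b * d * b⁻¹ = d ^ l := hl.symm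
  have hcd : Commute c d := h.cent hle hdN
  have had : Commute a d := (Commute.refl a).pow_right 4
  have hbc : Commute b c := (Commute.refl b).pow_right 2
  have hod : orderOf d = 4 := by rw [hd, orderOf_pow, ha]; norm_num
  have hoc : orderOf c = 4 := by rw [hc, orderOf_pow, hb]; norm_num
  have huniq : ∀ x y x' y' : ℤ, c ^ x * d ^ y = c ^ x' * d ^ y' → (4 : ℤ) ∣ x - x' ∧ (4 : ℤ) ∣ y - y' := by
    intro x y x' y' e
    have e' : b ^ (2 * x) * a ^ (4 * y) = b ^ (2 * x') * a ^ (4 * y') := by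
      rw [zpow_mul, zpow_mul, zpow_mul, zpow_mul]; exact_mod_cast e
    obtain ⟨e1, e2⟩ := h.symm.uniq e'
    have e1 : c ^ x = c ^ x' := by
      rw [hc, ← zpow_natCast, ← zpow_mul, ← zpow_mul]; exact_mod_cast e1
    have e2 : d ^ y = d ^ y' := by
      rw [hd, ← zpow_natCast, ← zpow_mul, ← zpow_mul]; exact_mod_cast e2
    have t1 := zpow_eq_zpow_iff_modEq.1 e1.symm
    have t2 := zpow_eq_zpow_iff_modEq.1 e2.symm
    rw [hoc] at t1
    rw [hod] at t2
    exact ⟨t1.dvd, t2.dvd⟩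
  obtain ⟨r1, r2⟩ := huniq 1 0 _ _ (by simpa using h.conj_rel hbc hcd had hconj hl)
  -- ν odd
  have hνo : ¬ (2 : ℤ) ∣ ν := by
    rintro ⟨w, hw⟩
    have : a * (c ^ 2) * a⁻¹ = (c ^ 2) ^ μ := by
      rw [← conj_pow, hconj, (hcd.zpow_zpow μ ν).mul_pow, hw]
      have : (d ^ (2 * w)) ^ 2 = 1 := by
        rw [← zpow_natCast, ← zpow_mul, ← orderOf_dvd_iff_zpow_eq_one, hod]
        exact ⟨w, by push_cast; ring⟩
      rw [this, mul_one, ← zpow_natCast, ← zpow_mul, ← zpow_natCast, ← zpow_mul, mul_comm]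
    have := h.core_triv hB (Subgroup.pow_mem _ (Subgroup.pow_mem _ (Subgroup.mem_zpowers b) 2) 2) this
    rw [← orderOf_dvd_iff_pow_eq_one, hoc] at this
    norm_num at this
  -- the square of the conjugate of a
  have hcs : ∀ s : ℤ, a * c ^ s * a⁻¹ = c ^ (μ * s) * d ^ (ν * s) := by
    intro s
    rw [← conj_zpow, hconj, (hcd.zpow_zpow μ ν).mul_zpow, ← zpow_mul, ← zpow_mul]
  have hE : b * a ^ 2 * b⁻¹ = (a ^ 2)⁻¹ * (c ^ (-μ - 1) * d ^ (-ν)) := by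
    have e := hcs (-1)
    have hx := (hcd.zpow_zpow (-1) (ν * -1)).eq
    calc b * a ^ 2 * b⁻¹ = (b * a * b⁻¹) * (b * a * b⁻¹) := by rw [pow_two]; group
      _ = (a ^ 2)⁻¹ * (a * c ^ (-1 : ℤ) * a⁻¹) * c ^ (-1 : ℤ) := by rw [h.rel', ← hc, pow_two]; group
      _ = (a ^ 2)⁻¹ * c ^ (μ * -1) * (d ^ (ν * -1) * c ^ (-1 : ℤ)) := by rw [e]; group
      _ = _ := by
        rw [← hx]
        have : c ^ (-μ - 1) = c ^ (μ * -1) * c ^ (-1 : ℤ) := by rw [← zpow_add]; congr 1; ring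
        rw [this, mul_neg_one ν]; group
  set s := -μ - 1 with hs'
  have hE2 : b * d * b⁻¹ = c ^ ((μ * μ + 1) * s) * d ^ (ν * (μ * s) + ν * s - 2 * ν - 1) := by
    have e1 : a ^ 2 * c ^ s * (a ^ 2)⁻¹ = c ^ (μ * (μ * s)) * d ^ (ν * (μ * s) + ν * s) := by
      have hd1 := (had.zpow_right (ν * s)).eq
      calc a ^ 2 * c ^ s * (a ^ 2)⁻¹ = a * (a * c ^ s * a⁻¹) * a⁻¹ := by rw [pow_two]; group
        _ = (a * c ^ (μ * s) * a⁻¹) * (a * d ^ (ν * s)) * a⁻¹ := by rw [hcs]; group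
        _ = _ := by rw [hd1, hcs, zpow_add]; group
    have hdc : ∀ x y : ℤ, d ^ x * c ^ y = c ^ y * d ^ x := fun x y => (hcd.zpow_zpow y x).eq.symm
    have ha2 : ∀ x : ℤ, d ^ x * (a ^ 2)⁻¹ = (a ^ 2)⁻¹ * d ^ x :=
      fun x => ((had.zpow_right x).pow_left 2).inv_left.eq.symm
    calc b * d * b⁻¹ = (b * a ^ 2 * b⁻¹) * (b * a ^ 2 * b⁻¹) := by rw [hd]; group
      _ = (a ^ 2)⁻¹ * c ^ s * (d ^ (-ν) * (a ^ 2)⁻¹) * (c ^ s * d ^ (-ν)) := by rw [hE]; group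
      _ = (a ^ 4)⁻¹ * (a ^ 2 * c ^ s * (a ^ 2)⁻¹) * d ^ (-ν) * c ^ s * d ^ (-ν) := by rw [ha2]; group
      _ = d ^ (-1 : ℤ) * c ^ (μ * (μ * s)) * (d ^ (ν * (μ * s) + ν * s) * d ^ (-ν) * c ^ s * d ^ (-ν)) := by
        rw [e1, ← hd]; group
      _ = _ := by
        have z : d ^ (ν * (μ * s) + ν * s - 2 * ν - 1) =
            d ^ (-1 : ℤ) * (d ^ (ν * (μ * s) + ν * s) * d ^ (-ν)) * d ^ (-ν) := by
          rw [← zpow_add, ← zpow_add, ← zpow_add]; congr 1; ring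
        have z2 : c ^ ((μ * μ + 1) * s) = c ^ (μ * (μ * s)) * c ^ s := by
          rw [← zpow_add]; congr 1; ring
        rw [z, z2, ← zpow_add, hdc, hdc]
        have := hdc (-1) s
        calc c ^ (μ * (μ * s)) * d ^ (-1 : ℤ) * (c ^ s * d ^ (ν * (μ * s) + ν * s + -ν) * d ^ (-ν))
          = c ^ (μ * (μ * s)) * (d ^ (-1 : ℤ) * c ^ s) * d ^ (ν * (μ * s) + ν * s + -ν) * d ^ (-ν) := by
              simp only [mul_assoc]
          _ = _ := by rw [this]; simp only [mul_assoc]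
  rw [hl] at hE2
  obtain ⟨r3, r4⟩ := huniq 0 l _ _ (by simpa using hE2)
  have hμ : (4 : ℤ) ∣ μ + 1 := by
    rw [hs'] at r4
    have key : ∀ m n k : ZMod 4, 1 - m * m = 0 → 0 - n * (m + k) = 0 →
        k - (n * (m * (-m - 1)) + n * (-m - 1) - 2 * n - 1) = 0 → 2 * n ≠ 0 → m + 1 = 0 := by decide
    have c1 := (ZMod.intCast_zmod_eq_zero_iff_dvd _ 4).2 (by exact_mod_cast r1)
    have c2 := (ZMod.intCast_zmod_eq_zero_iff_dvd _ 4).2 (by exact_mod_cast r2)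
    have c4 := (ZMod.intCast_zmod_eq_zero_iff_dvd _ 4).2 (by exact_mod_cast r4)
    push_cast at c1 c2 c4
    have := key μ ν l c1 c2 c4 (by
      intro h0
      have h0 : ((2 * ν : ℤ) : ZMod 4) = 0 := by push_cast; exact h0
      have := (ZMod.intCast_zmod_eq_zero_iff_dvd _ 4).1 h0
      push_cast at this
      omega)
    have := (ZMod.intCast_zmod_eq_zero_iff_dvd (μ + 1) 4).1 (by push_cast; exact this)
    exact_mod_cast this
  have hcs1 : c ^ s = 1 := by
    rw [← orderOf_dvd_iff_zpow_eq_one, hoc, hs']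
    push_cast; omega
  rw [hcs1, one_mul] at hE
  have hn2 : (Subgroup.zpowers (a ^ 2)).Normal := by
    apply h.normal
    · rintro _ ⟨u, rfl⟩
      refine ⟨u, ?_⟩
      show (a ^ 2) ^ u = a * (a ^ 2) ^ u * a⁻¹
      group
    · rintro _ ⟨u, rfl⟩
      show b * (a ^ 2) ^ u * b⁻¹ ∈ _
      rw [← conj_zpow, hE]
      apply Subgroup.zpow_mem
      apply Subgroup.mul_mem _ (Subgroup.inv_mem _ (Subgroup.mem_zpowers _))
      apply Subgroup.zpow_mem
      have : d = (a ^ 2) ^ 2 := by rw [hd, ← pow_mul]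
      rw [this]
      exact Subgroup.pow_mem _ (Subgroup.mem_zpowers _) 2
  have h2N : Subgroup.zpowers (a ^ 2) ≤ coreA a :=
    Subgroup.normal_le_normalCore.2 (by
      rw [Subgroup.zpowers_le]; exact Subgroup.pow_mem _ (Subgroup.mem_zpowers a) 2)
  have := (mem_iff_dvd (coreA a) a 2).1 (by exact_mod_cast h2N (Subgroup.mem_zpowers _))
  rw [hk] at this
  norm_num at this

end step
theorem orderOf_zp_dvd {G : Type*} [Group G] {x : G} (i : ℤ) : orderOf (x ^ i) ∣ orderOf x := by
  apply orderOf_dvd_of_pow_eq_one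
  rw [← zpow_natCast, ← zpow_mul, mul_comm, zpow_mul, zpow_natCast, pow_orderOf_eq_one, one_zpow]

theorem TP.case_odd {G : Type} [Group G] [Finite G] {a b : G} (h : TP a b) {m : ℕ} (hm : m.Prime)
    (hmo : Odd m) (hmp : ¬ (m ∣ orderOf b ∧ m ^ 2 ∣ orderOf a)) (hmq : ¬ (m ∣ orderOf a ∧ m ^ 2 ∣ orderOf b))
    (hB : coreA b = ⊥) {c n : G} (hcb : c ∈ Subgroup.zpowers b) (hoc : orderOf c = m) {μ : ℤ}
    (hn : n ∈ coreA a) (hconj : a * c * a⁻¹ = c ^ μ * n)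
    (hIH : ∀ (K : Subgroup G) [K.Normal], K ≠ ⊥ → TP (a : G ⧸ K) (b : G ⧸ K) →
      RegMod a b (QuotientGroup.mk' K)) : RegP a b := by
  have hfm := Fact.mk hm
  have hle := Subgroup.normalCore_le (Subgroup.zpowers a)
  obtain ⟨j, hj⟩ := hcb
  have hj : b ^ j = c := hj
  have hbc : Commute b c := by rw [← hj]; exact (Commute.refl b).zpow_right j
  -- c commutes with the core
  have hcN : ∀ x ∈ coreA a, Commute c x := by
    intro x hx
    obtain ⟨k, hk⟩ := hmo
    have e : c = (b ^ 2) ^ (j * (k + 1)) := by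
      have : c = (c ^ 2) ^ (k + 1) := by
        have e : 2 * (k + 1) = orderOf c + 1 := by omega
        rw [← pow_mul, e, pow_succ, pow_orderOf_eq_one, one_mul]
      rw [this, ← hj, ← zpow_natCast, ← zpow_natCast, ← zpow_natCast, ← zpow_mul, ← zpow_mul, ← zpow_mul]
      congr 1; push_cast; ring
    have h2 : Commute (b ^ 2) x := h.cent hle hx
    rw [e]; exact h2.zpow_left _
  have hcn : Commute c n := hcN n hn
  obtain ⟨i, hi⟩ := hle hn
  have hi : a ^ i = n := hi
  have han : Commute a n := by rw [← hi]; exact (Commute.refl a).zpow_right i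
  have hn1 : n ≠ 1 := by
    rintro rfl
    have := h.core_triv hB ⟨j, hj⟩ (by rw [hconj, mul_one])
    rw [this, orderOf_one] at hoc
    exact hm.one_lt.ne hoc
  have hnm : n ^ m = 1 := by
    have e1 : (a * c * a⁻¹) ^ m = 1 := by
      rw [conj_pow, ← hoc, pow_orderOf_eq_one]; group
    rw [hconj, (hcn.zpow_left μ).mul_pow, ← zpow_natCast, ← zpow_mul, mul_comm, zpow_mul, zpow_natCast,
      ← hoc, pow_orderOf_eq_one, one_zpow, one_mul, hoc] at e1
    exact e1
  have hon : orderOf n = m := orderOf_eq_prime hnm hn1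
  have hnn := zpowers_normal_of_core hle hn
  obtain ⟨l, hl⟩ := hnn.conj_mem n (Subgroup.mem_zpowers n) b
  have hl : b * n * b⁻¹ = n ^ l := hl.symm
  have hma : m ∣ orderOf a := by rw [← hon, ← hi]; exact orderOf_zp_dvd i
  have hmb : m ∣ orderOf b := by rw [← hoc, ← hj]; exact orderOf_zp_dvd j
  have hmp : ¬ m ^ 2 ∣ orderOf a := fun e => hmp ⟨hmb, e⟩
  have hmq : ¬ m ^ 2 ∣ orderOf b := fun e => hmq ⟨hma, e⟩
  have huniq : ∀ x y x' y' : ℤ, c ^ x * n ^ y = c ^ x' * n ^ y' → (m : ℤ) ∣ x' - x ∧ (m : ℤ) ∣ y' - y := by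
    intro x y x' y' e
    have e' : b ^ (j * x) * a ^ (i * y) = b ^ (j * x') * a ^ (i * y') := by
      rw [zpow_mul, zpow_mul, zpow_mul, zpow_mul, hi, hj]; exact e
    obtain ⟨e1, e2⟩ := h.symm.uniq e'
    rw [zpow_mul, zpow_mul, hj] at e1
    rw [zpow_mul, zpow_mul, hi] at e2
    have t1 := zpow_eq_zpow_iff_modEq.1 e1
    have t2 := zpow_eq_zpow_iff_modEq.1 e2
    rw [hoc] at t1
    rw [hon] at t2
    exact ⟨t1.dvd, t2.dvd⟩
  obtain ⟨r1, r2⟩ := huniq 1 0 _ _ (by simpa using h.conj_rel (ν := 1) hbc hcn han (by simpa using hconj) hl)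
  -- μ ≠ 1
  have hcpow : ∀ t : ℤ, (m : ℤ) ∣ t → c ^ t = 1 := fun t ht => by
    rw [← orderOf_dvd_iff_zpow_eq_one, hoc]; exact ht
  have hμ1 : ¬ (m : ℤ) ∣ μ - 1 := by
    intro hd
    have hc1 : c ^ μ = c := by
      have := hcpow _ hd
      rw [zpow_sub, zpow_one, mul_inv_eq_one] at this
      exact this
    rw [hc1] at hconj
    have hpw : ∀ t : ℕ, a ^ t * c * (a ^ t)⁻¹ = c * n ^ t := by
      intro t
      induction t with
      | zero => simp
      | succ t ih =>
        calc a ^ (t + 1) * c * (a ^ (t + 1))⁻¹ = a ^ t * (a * c * a⁻¹) * (a ^ t)⁻¹ := by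
              rw [pow_succ]; group
          _ = a ^ t * c * (a ^ t)⁻¹ * (a ^ t * n) * (a ^ t)⁻¹ := by rw [hconj]; group
          _ = _ := by rw [ih, (han.pow_left t).eq, pow_succ]; group
    set k := orderOf (a : G ⧸ coreA a) with hk
    have hkN : a ^ k ∈ coreA a := by
      have := (mem_iff_dvd (coreA a) a k).2 dvd_rfl
      exact_mod_cast this
    have hnk : n ^ k = 1 := by
      have e := hpw k
      rw [← (hcN _ hkN).eq, mul_inv_cancel_right] at e
      exact (left_eq_mul.1 e)
    have hmk : m ∣ k := by rw [← hon]; exact orderOf_dvd_of_pow_eq_one hnk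
    have hkp : k ∣ orderOf a := orderOf_map_dvd (QuotientGroup.mk' _) a
    have hmk2 : m ∣ orderOf a / k := by
      rw [← orderOf_pow_of_dvd (orderOf_pos _).ne' hkp, ← hon]
      rw [← hi, mem_iff_dvd] at hn
      obtain ⟨u, hu⟩ := hn
      rw [← hi, hu, zpow_mul, zpow_natCast]
      exact orderOf_zp_dvd u
    apply hmp
    rw [pow_two]
    calc m * m ∣ k * (orderOf a / k) := Nat.mul_dvd_mul hmk hmk2
      _ = _ := Nat.mul_div_cancel' hkp
  have hmi : Prime (m : ℤ) := Nat.prime_iff_prime_int.1 hm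
  have hμ2 : (m : ℤ) ∣ μ + 1 := by
    have : (m : ℤ) ∣ (μ - 1) * (μ + 1) := by
      have e : (μ - 1) * (μ + 1) = μ * μ - 1 := by ring
      rw [e]; exact r1
    exact (hmi.dvd_or_dvd this).resolve_left hμ1
  have hl1 : (m : ℤ) ∣ l - 1 := by
    have e : l - 1 = (μ + l - 0) - (μ + 1) := by ring
    rw [e]; exact dvd_sub r2 hμ2
  have hbn : Commute b n := by
    have : n ^ l = n := by
      have : n ^ (l - 1) = 1 := by rw [← orderOf_dvd_iff_zpow_eq_one, hon]; exact hl1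
      rw [zpow_sub, zpow_one, mul_inv_eq_one] at this
      exact this
    rw [this] at hl
    exact mul_inv_eq_iff_eq_mul.1 hl
  have hconj2 : a * c * a⁻¹ = c⁻¹ * n := by
    have : c ^ μ = c⁻¹ := by
      have := hcpow _ hμ2
      rw [zpow_add, zpow_one] at this
      exact eq_inv_of_mul_eq_one_left this
    rw [hconj, this]
  have hcen : ∀ g : G, g * n = n * g := by
    intro g
    obtain ⟨x, y, rfl⟩ := h.tight g
    exact ((han.zpow_left x).mul_left (hbn.zpow_left y)).eq
  set y := c ^ 2 * n⁻¹ with hy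
  have hya : a * y * a⁻¹ = y⁻¹ := by
    have hx := hcn.inv_left.mul_pow 2
    have hn2 : a * n⁻¹ * a⁻¹ = n⁻¹ := by
      rw [han.inv_right.eq]; group
    calc a * y * a⁻¹ = (a * c * a⁻¹) ^ 2 * (a * n⁻¹ * a⁻¹) := by rw [conj_pow, hy]; group
      _ = (c ^ 2)⁻¹ * n := by rw [hn2, hconj2, hx]; group
      _ = _ := by rw [((hcn.pow_left 2).inv_left).eq, hy]; group
  have hKn : (Subgroup.zpowers y).Normal := by
    apply h.normal
    · rintro _ ⟨u, rfl⟩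
      refine ⟨-u, ?_⟩
      show y ^ (-u) = a * y ^ u * a⁻¹
      rw [← conj_zpow, hya]; group
    · rintro _ ⟨u, rfl⟩
      refine ⟨u, ?_⟩
      show y ^ u = b * y ^ u * b⁻¹
      have : Commute b y := (hbc.pow_right 2).mul_right hbn.inv_right
      rw [(this.zpow_right u).eq]; group
  have hyz : ∀ u : ℤ, y ^ u = c ^ (2 * u) * n ^ (-u) := by
    intro u
    rw [hy, ((hcn.pow_left 2).inv_right).mul_zpow, inv_zpow', zpow_mul]; norm_cast
  have hdisj : ∀ u v : ℤ, n ^ u = y ^ v → n ^ u = 1 := by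
    intro u v e
    rw [e, hyz]
    rw [hyz] at e
    obtain ⟨e1, -⟩ := huniq 0 u (2 * v) (-v) (by rw [zpow_zero, one_mul]; exact e)
    rw [sub_zero] at e1
    have hv : (m : ℤ) ∣ v := by
      rcases hmi.dvd_or_dvd e1 with e | e
      · exfalso
        have : m ∣ 2 := by exact_mod_cast e
        have := (Nat.prime_dvd_prime_iff_eq hm Nat.prime_two).1 this
        subst this
        exact absurd hmo (by decide)
      · exact e
    rw [hcpow _ e1, one_mul, ← orderOf_dvd_iff_zpow_eq_one, hon]
    exact (dvd_neg).2 hv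
  have hoy : orderOf y = m := by
    apply orderOf_eq_prime
    · have := hyz m
      rw [hcpow _ (Dvd.intro_left _ rfl), one_mul, zpow_neg, zpow_natCast, zpow_natCast, hnm, inv_one] at this
      exact this
    · intro e
      obtain ⟨_, e2⟩ := huniq 0 0 (2 * 1) (-1) (by rw [← hyz 1]; simp [e])
      have : (m : ℤ) ∣ 1 := by simpa using e2
      have : m ∣ 1 := by exact_mod_cast this
      exact hm.one_lt.ne' (Nat.dvd_one.1 this)
  let f : G →* Subgroup.center (G ⧸ Subgroup.zpowers y) :=
    (MonoidHom.transferCenterPow _).comp (QuotientGroup.mk' (Subgroup.zpowers y))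
  have hf : ∀ x, ((f x : Subgroup.center (G ⧸ Subgroup.zpowers y)) : G ⧸ Subgroup.zpowers y)
      = ((x ^ (Subgroup.center (G ⧸ Subgroup.zpowers y)).index : G) : G ⧸ Subgroup.zpowers y) := by
    intro x
    show ((MonoidHom.transferCenterPow _ (x : G ⧸ Subgroup.zpowers y) : Subgroup.center (G ⧸ Subgroup.zpowers y)) : G ⧸ Subgroup.zpowers y) = _
    rw [MonoidHom.transferCenterPow_apply, QuotientGroup.mk_pow]
  set I := (Subgroup.center (G ⧸ Subgroup.zpowers y)).index with hI
  have hIm : ¬ m ∣ I := by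
    intro hd
    have e1 := Subgroup.index_mul_card (Subgroup.center (G ⧸ Subgroup.zpowers y))
    have e2 := Subgroup.card_eq_card_quotient_mul_card_subgroup (Subgroup.zpowers y)
    rw [h.card, Nat.card_zpowers, hoy, ← e1] at e2
    have hZ : m ∣ Nat.card (Subgroup.center (G ⧸ Subgroup.zpowers y)) := by
      have hz : (n : G ⧸ Subgroup.zpowers y) ∈ Subgroup.center (G ⧸ Subgroup.zpowers y) := by
        rw [Subgroup.mem_center_iff]
        intro g
        induction g using QuotientGroup.induction_on with
        | H g => rw [← QuotientGroup.mk_mul, ← QuotientGroup.mk_mul, hcen]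
      have ho : orderOf (⟨_, hz⟩ : Subgroup.center (G ⧸ Subgroup.zpowers y)) = m := by
        rw [Subgroup.orderOf_mk]
        apply orderOf_eq_prime
        · rw [← QuotientGroup.mk_pow, hnm]; rfl
        · intro e
          rw [QuotientGroup.eq_one_iff] at e
          obtain ⟨v, hv⟩ := e
          have hv : y ^ v = n := hv
          apply hn1
          simpa using hdisj 1 v (by simpa using hv.symm)
      rw [← ho]
      exact orderOf_dvd_natCard _
    obtain ⟨p', hp'⟩ := hma
    obtain ⟨q', hq'⟩ := hmb
    obtain ⟨I', hI'⟩ := hd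
    obtain ⟨Z', hZ'⟩ := hZ
    rw [hp', hq', ← hI, hI', hZ'] at e2
    have hm0 := hm.pos
    have e3 : p' * q' = m * (I' * Z') := by
      have : (m * m) * (p' * q') = (m * m) * (m * (I' * Z')) := by
        calc (m * m) * (p' * q') = m * p' * (m * q') := by ring
          _ = _ := e2
          _ = _ := by ring
      exact Nat.eq_of_mul_eq_mul_left (by positivity) this
    rcases (hm.dvd_mul.1 (Dvd.intro _ e3.symm)) with hd | hd
    · exact hmp (by rw [hp', pow_two]; exact Nat.mul_dvd_mul_left m hd)
    · exact hmq (by rw [hq', pow_two]; exact Nat.mul_dvd_mul_left m hd)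
  have hnK : Subgroup.zpowers n ≠ ⊥ := by rwa [Ne, Subgroup.zpowers_eq_bot]
  have hnle : Subgroup.zpowers n ≤ Subgroup.zpowers a := by rw [Subgroup.zpowers_le]; exact ⟨i, hi⟩
  refine RegP.of_two (QuotientGroup.mk' (Subgroup.zpowers n)) f
    (hIH _ hnK (h.quot (h.fact_le hnle))) (RegMod.of_comm f ?_) ?_
  · intro x z
    ext
    exact Subgroup.mem_center_iff.1 (f z).2 _
  · intro x hx hfx
    have hx : (x : G ⧸ Subgroup.zpowers n) = 1 := hx
    rw [QuotientGroup.eq_one_iff] at hx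
    obtain ⟨u, hu⟩ := hx
    have hu : n ^ u = x := hu
    have e := hf x
    rw [hfx, Subgroup.coe_one, eq_comm, QuotientGroup.eq_one_iff] at e
    obtain ⟨v, hv⟩ := e
    have hv : y ^ v = x ^ I := hv
    have e1 : n ^ (u * I) = y ^ v := by rw [hv, ← hu, zpow_mul, zpow_natCast]
    have e2 := hdisj _ _ e1
    rw [← orderOf_dvd_iff_zpow_eq_one, hon] at e2
    rcases hmi.dvd_or_dvd e2 with e | e
    · rw [← hu, ← orderOf_dvd_iff_zpow_eq_one, hon]; exact e
    · exact absurd (by exact_mod_cast e) hIm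
/-- the arithmetic condition -/
def CC (p q : ℕ) : Prop :=
  (∃ m : ℕ, m.Prime ∧ Odd m ∧ m ∣ p ∧ m ^ 2 ∣ q) ∨ (∃ m : ℕ, m.Prime ∧ Odd m ∧ m ∣ q ∧ m ^ 2 ∣ p) ∨
    (8 ∣ p ∧ 32 ∣ q) ∨ (8 ∣ q ∧ 32 ∣ p)

theorem CC.symm {p q : ℕ} (h : CC p q) : CC q p := by
  rcases h with h | h | h | h
  · exact Or.inr (Or.inl h)
  · exact Or.inl h
  · exact Or.inr (Or.inr (Or.inr h))
  · exact Or.inr (Or.inr (Or.inl h))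

theorem CC.mono {p q p' q' : ℕ} (h : CC p q) (hp : p ∣ p') (hq : q ∣ q') : CC p' q' := by
  rcases h with ⟨m, h1, h2, h3, h4⟩ | ⟨m, h1, h2, h3, h4⟩ | ⟨h1, h2⟩ | ⟨h1, h2⟩
  · exact Or.inl ⟨m, h1, h2, h3.trans hp, h4.trans hq⟩
  · exact Or.inr (Or.inl ⟨m, h1, h2, h3.trans hq, h4.trans hp⟩)
  · exact Or.inr (Or.inr (Or.inl ⟨h1.trans hp, h2.trans hq⟩))
  · exact Or.inr (Or.inr (Or.inr ⟨h1.trans hq, h2.trans hp⟩))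

theorem TP.quot_two {G : Type} [Group G] [Finite G] {a b : G} (h : TP a b) (O : Subgroup G) [O.Normal]
    (hodd : Odd (Nat.card O)) (hp2 : IsPGroup 2 (G ⧸ O)) : TP (a : G ⧸ O) (b : G ⧸ O) := by
  have htight : ∀ g : G ⧸ O, ∃ i j : ℤ, g = (a : G ⧸ O) ^ i * (b : G ⧸ O) ^ j := by
    intro g
    induction g using QuotientGroup.induction_on with
    | H g =>
      obtain ⟨i, j, rfl⟩ := h.tight g
      exact ⟨i, j, by simp⟩
  refine ⟨?_, ?_, htight⟩
  · have := congrArg (QuotientGroup.mk' O) h.inv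
    simpa using this
  · have := Fact.mk Nat.prime_two
    obtain ⟨x, hx⟩ := IsPGroup.iff_orderOf.1 hp2 (a : G ⧸ O)
    obtain ⟨y, hy⟩ := IsPGroup.iff_orderOf.1 hp2 (b : G ⧸ O)
    have hxa : orderOf (a : G ⧸ O) ∣ orderOf a := orderOf_map_dvd (QuotientGroup.mk' _) a
    have hyb : orderOf (b : G ⧸ O) ∣ orderOf b := orderOf_map_dvd (QuotientGroup.mk' _) b
    have hd : orderOf (a : G ⧸ O) * orderOf (b : G ⧸ O) ∣ Nat.card (G ⧸ O) := by
      have h1 := Nat.mul_dvd_mul hxa hyb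
      rw [← h.card, Subgroup.card_eq_card_quotient_mul_card_subgroup O] at h1
      refine Nat.Coprime.dvd_of_dvd_mul_right ?_ h1
      rw [hx, hy, ← pow_add]
      exact Nat.Coprime.pow_left _ (Nat.coprime_two_left.2 hodd)
    let F : Subgroup.zpowers (a : G ⧸ O) × Subgroup.zpowers (b : G ⧸ O) → G ⧸ O := fun z => z.1 * z.2
    have hF : Function.Surjective F := by
      intro g
      obtain ⟨i, j, rfl⟩ := htight g
      exact ⟨(⟨_, i, rfl⟩, ⟨_, j, rfl⟩), rfl⟩
    have hbij : Function.Bijective F := by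
      apply Function.Surjective.bijective_of_nat_card_le hF
      rw [Nat.card_prod, Nat.card_zpowers, Nat.card_zpowers]
      exact Nat.le_of_dvd Nat.card_pos hd
    intro i j e
    have := hbij.1 (a₁ := (⟨(a : G ⧸ O) ^ i, i, rfl⟩, 1)) (a₂ := (1, ⟨(b : G ⧸ O) ^ j, j, rfl⟩)) (by
      simp only [F, Subgroup.coe_one, mul_one, one_mul]; exact e)
    exact congrArg Subtype.val (congrArg Prod.fst this)

theorem TP.step {G : Type} [Group G] [Finite G] {a b : G} (h : TP a b) 
    (hC : ¬ CC (orderOf a) (orderOf b))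
    (hIH : ∀ (K : Subgroup G) [K.Normal], K ≠ ⊥ → TP (a : G ⧸ K) (b : G ⧸ K) →
      RegMod a b (QuotientGroup.mk' K)) (hpq : orderOf b ≤ orderOf a) : RegP a b := by
  have hle := Subgroup.normalCore_le (Subgroup.zpowers a)
  have hleb := Subgroup.normalCore_le (Subgroup.zpowers b)
  have hp0 : 0 < orderOf a := orderOf_pos a
  have hq0 : 0 < orderOf b := orderOf_pos b
  by_cases hp1 : orderOf a = 1
  · have hb1 : orderOf b = 1 := by omega
    rw [orderOf_eq_one_iff] at hp1 hb1
    intro i x y _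
    simp [hp1, hb1]
  have hN : coreA a ≠ ⊥ := h.core_ne hpq (by omega)
  by_cases hB : coreA b = ⊥
  swap
  · refine RegP.of_two _ _ (hIH _ hN (h.quot (h.fact_le hle))) (hIH _ hB (h.quot (h.fact_le' hleb))) ?_
    intro x hx hx'
    have hx : (x : G ⧸ coreA a) = 1 := hx
    have hx' : (x : G ⧸ coreA b) = 1 := hx'
    rw [QuotientGroup.eq_one_iff] at hx hx'
    obtain ⟨i, hi⟩ := hle hx
    obtain ⟨j, hj⟩ := hleb hx'
    have hi : a ^ i = x := hi
    have hj : b ^ j = x := hj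
    rw [← hi]; exact h.disj i j (hi.trans hj.symm)
  have hqp : orderOf b < orderOf a := by
    rcases hpq.lt_or_eq with e | e
    · exact e
    · exact absurd hB (h.symm.core_ne (by omega) (by omega))
  set k := orderOf (a : G ⧸ coreA a) with hk
  have hkp : k ∣ orderOf a := orderOf_map_dvd (QuotientGroup.mk' _) a
  have hk0 : 0 < k := orderOf_pos _
  by_cases hk2 : k ∣ 2
  · have ha2 : a ^ 2 ∈ coreA a := by
      have := (mem_iff_dvd (coreA a) a 2).2 (by exact_mod_cast hk2)
      exact_mod_cast this
    obtain ⟨l, hl⟩ := (zpowers_normal_of_core hle ha2).conj_mem _ (Subgroup.mem_zpowers _) b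
    have hl : (a ^ 2) ^ l = b * a ^ 2 * b⁻¹ := hl
    exact h.reg_of_sq (l := l) (by rw [← hl, zpow_mul]; norm_cast) (h.cent hle ha2)
  have hk3 : 3 ≤ k := by
    by_contra hlt
    have : k < 3 := by omega
    interval_cases k
    · exact hk2 (by norm_num)
    · exact hk2 (by norm_num)
  have hkq : k < orderOf b := by
    rcases h.core_quot with e | e
    · exact e
    · omega
  rcases Nat.even_or_odd (Nat.card (coreA a)) with hev | hodd
  · -- Case I
    have := Fact.mk Nat.prime_two
    obtain ⟨z, hz⟩ := exists_prime_orderOf_dvd_card' (G := coreA a) 2 hev.two_dvd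
    have hoz : orderOf (z : G) = 2 := by rw [Subgroup.orderOf_coe, hz]
    have hzn := zpowers_normal_of_core hle z.2
    have hzle : Subgroup.zpowers (z : G) ≤ Subgroup.zpowers a := by
      rw [Subgroup.zpowers_le]; exact hle z.2
    have hzb : Subgroup.zpowers (z : G) ≠ ⊥ := by
      rw [Ne, Subgroup.zpowers_eq_bot]
      intro e
      rw [e, orderOf_one] at hoz
      norm_num at hoz
    obtain ⟨O, hOn, hOodd, hO2⟩ := two_compl _ G a b rfl h
    by_cases hO : O = ⊥
    · exfalso
      subst hO
      have hpow : ∀ x : G, ∃ e : ℕ, orderOf x = 2 ^ e := by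
        intro x
        obtain ⟨e, he⟩ := hO2 (x : G ⧸ (⊥ : Subgroup G))
        rw [← QuotientGroup.mk_pow, QuotientGroup.eq_one_iff, Subgroup.mem_bot] at he
        obtain ⟨e', _, he'⟩ := (Nat.dvd_prime_pow Nat.prime_two).1 (orderOf_dvd_of_pow_eq_one he)
        exact ⟨e', he'⟩
      obtain ⟨α, hα⟩ := hpow a
      obtain ⟨β, hβ⟩ := hpow b
      obtain ⟨κ, _, hκ⟩ := (Nat.dvd_prime_pow Nat.prime_two).1 (hα ▸ hkp)
      have k1 : 2 ≤ κ := by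
        by_contra hc
        have : κ < 2 := by omega
        interval_cases κ <;> omega
      have k2 : κ < β := by
        rw [hκ, hβ] at hkq
        exact (Nat.pow_lt_pow_iff_right (by norm_num)).1 hkq
      have k3 : β < α := by
        rw [hα, hβ] at hqp
        exact (Nat.pow_lt_pow_iff_right (by norm_num)).1 hqp
      have k4 : α < 5 := by
        by_contra hc
        apply hC
        refine Or.inr (Or.inr (Or.inr ⟨?_, ?_⟩))
        · rw [hβ, show 8 = 2 ^ 3 by norm_num]; exact pow_dvd_pow 2 (by omega)
        · rw [hα, show 32 = 2 ^ 5 by norm_num]; exact pow_dvd_pow 2 (by omega)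
      have hα4 : α = 4 := by omega
      have hβ3 : β = 3 := by omega
      have hκ2 : κ = 2 := by omega
      subst hα4 hβ3 hκ2
      exact h.case_two (by rw [hα]; norm_num) (by rw [hβ]; norm_num) (by rw [← hk, hκ]; norm_num) hB
    · refine RegP.of_two _ _ (hIH _ hzb (h.quot (h.fact_le hzle))) (hIH O hO (h.quot_two O hOodd hO2)) ?_
      intro x hx hx'
      have hx : (x : G ⧸ Subgroup.zpowers (z : G)) = 1 := hx
      have hx' : (x : G ⧸ O) = 1 := hx'
      rw [QuotientGroup.eq_one_iff] at hx hx'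
      have d1 : orderOf x ∣ 2 := by
        obtain ⟨u, hu⟩ := hx
        have hu : (z : G) ^ u = x := hu
        rw [← hu, ← hoz]; exact orderOf_zp_dvd u
      have d2 : orderOf x ∣ Nat.card O := by
        have := orderOf_dvd_natCard (⟨x, hx'⟩ : O)
        rwa [Subgroup.orderOf_mk] at this
      have := Nat.dvd_gcd d1 d2
      rw [(Nat.coprime_two_left.2 hOodd : Nat.gcd 2 _ = 1), Nat.dvd_one, orderOf_eq_one_iff] at this
      exact this
  · -- Case II
    have hq := h.quot (K := coreA a) (h.fact_le hle)
    have hob : orderOf (b : G ⧸ coreA a) = orderOf b := h.order_b hle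
    have hMle : (coreA (b : G ⧸ coreA a)) ≤ Subgroup.zpowers (b : G ⧸ coreA a) := Subgroup.normalCore_le _
    have hs := hq.symm.core_quot
    rw [← hk] at hs
    set s := orderOf ((b : G ⧸ coreA a) : (G ⧸ coreA a) ⧸ (coreA (b : G ⧸ coreA a))) with hsdef
    have hs0 : 0 < s := orderOf_pos _
    have hsk : s < k := by omega
    have hsq : s ∣ orderOf b := hob ▸ orderOf_map_dvd (QuotientGroup.mk' (coreA (b : G ⧸ coreA a))) (b : G ⧸ coreA a)
    have hconj : ∀ j : ℕ, s ∣ j → ∃ (l : ℤ) (n : G), n ∈ coreA a ∧ a * b ^ j * a⁻¹ = (b ^ j) ^ l * n := by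
      intro j hj
      apply exists_conj (a := b) (coreA a)
      have := (mem_iff_dvd (coreA (b : G ⧸ coreA a)) (b : G ⧸ coreA a) j).2 (by exact_mod_cast hj)
      exact_mod_cast this
    obtain ⟨t, ht⟩ := hsq
    have ht2 : 2 ≤ t := by
      by_contra hc
      have : t < 2 := by omega
      interval_cases t <;> omega
    rcases Nat.eq_two_pow_or_exists_odd_prime_and_dvd t with ⟨u, hu⟩ | ⟨m, hm, ⟨t', ht'⟩, hmo⟩
    swap
    · have hqm : orderOf b = m * (s * t') := by rw [ht, ht']; ring
      obtain ⟨μ, n, hn, hc⟩ := hconj (s * t') (Dvd.intro _ rfl)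
      refine h.case_odd hm hmo ?_ ?_ hB (Subgroup.pow_mem _ (Subgroup.mem_zpowers b) _) ?_ hn hc hIH
      · rintro ⟨e1, e2⟩; exact hC (Or.inr (Or.inl ⟨m, hm, hmo, e1, e2⟩))
      · rintro ⟨e1, e2⟩; exact hC (Or.inl ⟨m, hm, hmo, e1, e2⟩)
      · have hpos : 0 < s * t' := by
          rcases Nat.eq_zero_or_pos (s * t') with e | e
          · rw [e, mul_zero] at hqm; omega
          · exact e
        rw [orderOf_pow_of_dvd hpos.ne' (hqm ▸ Dvd.intro_left _ rfl), hqm]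
        exact Nat.mul_div_cancel _ hpos
    · exfalso
      obtain ⟨v, rfl⟩ : ∃ v, u = v + 1 := by
        cases u with
        | zero => rw [hu] at ht2; norm_num at ht2
        | succ v => exact ⟨v, rfl⟩
      set j := s * 2 ^ v with hj
      have hqj : orderOf b = 2 * j := by rw [ht, hu, hj]; ring
      obtain ⟨μ, n, hn, hc⟩ := hconj j (Dvd.intro _ rfl)
      have hj0 : 0 < j := by omega
      rcases Nat.even_or_odd j with ⟨w, hw⟩ | hjo
      · have hcn : Commute (b ^ j) n := by
          have h2 : Commute (b ^ 2) n := h.cent hle hn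
          rw [hw, ← two_mul, pow_mul]
          exact h2.pow_left w
        have hc2 : (b ^ j) ^ 2 = 1 := by rw [← pow_mul, mul_comm, ← hqj, pow_orderOf_eq_one]
        have hn2 : n ^ 2 = 1 := by
          have e1 : (a * b ^ j * a⁻¹) ^ 2 = 1 := by
            rw [conj_pow, hc2]; group
          have e3 : ((b ^ j) ^ μ) ^ 2 = 1 := by
            rw [← zpow_natCast, ← zpow_mul, mul_comm, zpow_mul, zpow_natCast, hc2, one_zpow]
          rw [hc, (hcn.zpow_left μ).mul_pow, e3, one_mul] at e1
          exact e1
        have hn1 : n = 1 := by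
          have d2 : orderOf n ∣ Nat.card (coreA a) := by
            have := orderOf_dvd_natCard (⟨n, hn⟩ : coreA a)
            rwa [Subgroup.orderOf_mk] at this
          have := Nat.dvd_gcd (orderOf_dvd_of_pow_eq_one hn2) d2
          rw [(Nat.coprime_two_left.2 hodd : Nat.gcd 2 _ = 1), Nat.dvd_one, orderOf_eq_one_iff] at this
          exact this
        rw [hn1, mul_one] at hc
        have := h.core_triv hB (Subgroup.pow_mem _ (Subgroup.mem_zpowers b) _) hc
        have := Nat.le_of_dvd hj0 (orderOf_dvd_of_pow_eq_one this)
        omega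
      · have hso : Odd s := (Nat.odd_mul.1 hjo).1
        have hv0 : v = 0 := by
          by_contra hv
          have : Odd (2 ^ v) := (Nat.odd_mul.1 hjo).2
          rw [Nat.odd_pow_iff hv] at this
          exact absurd this (by decide)
        have hQ := hq.quot (K := (coreA (b : G ⧸ coreA a))) (hq.fact_le' hMle)
        have := parity _ _ _ _ rfl hQ.symm hso
        rw [hq.symm.order_b hMle, ← hk, ← hsdef] at this
        rw [hv0, pow_zero, mul_one] at hj
        rw [hj] at hqj
        obtain ⟨w, hw⟩ := this
        have hw2 : w < 2 := by
          by_contra hc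
          have : k * 2 ≤ k * w := Nat.mul_le_mul_left k (by omega)
          omega
        interval_cases w <;> omega

theorem TP.main : ∀ (n : ℕ) (G : Type) [Group G] [Finite G] (a b : G), Nat.card G = n → TP a b →
    ¬ CC (orderOf a) (orderOf b) → IsOrientablyRegular a b := by
  intro n
  induction n using Nat.strong_induction_on with
  | _ n ih =>
  have key : ∀ (G : Type) [Group G] [Finite G] (a b : G), Nat.card G = n → TP a b →
    ¬ CC (orderOf a) (orderOf b) → ∀ (K : Subgroup G) [K.Normal], K ≠ ⊥ → TP (a : G ⧸ K) (b : G ⧸ K) →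
      RegMod a b (QuotientGroup.mk' K) := by
    intro G _ _ a b hn h hC K _ hK hT
    apply RegMod.of_OR
    refine ih _ (hn ▸ card_quot_lt hK) (G ⧸ K) _ _ rfl hT ?_
    intro hc
    exact hC (hc.mono (orderOf_map_dvd (QuotientGroup.mk' K) a) (orderOf_map_dvd (QuotientGroup.mk' K) b))
  intro G _ _ a b hn h hC
  rcases le_total (orderOf b) (orderOf a) with hpq | hpq
  · exact RegP.toOR h (h.step hC (key G a b hn h hC) hpq)
  · have hC' : ¬ CC (orderOf b) (orderOf a) := fun e => hC e.symm
    exact OR_symm (RegP.toOR h.symm (h.symm.step hC' (key G b a hn h.symm hC') hpq))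

theorem necessity {G : Type} [Group G] [Finite G] {a b : G} {p q : ℕ} (hr : IsRotPair a b p q)
    (ht : IsTight a b) (hc : IsChiral a b) :
      ((Odd q ∧ Even p ∧ p ∣ 2 * q ∧ ∃ m : ℕ, m.Prime ∧ Odd m ∧ m ∣ p ∧ m ^ 2 ∣ q) ∨
       (Odd p ∧ Even q ∧ q ∣ 2 * p ∧ ∃ m : ℕ, m.Prime ∧ Odd m ∧ m ∣ q ∧ m ^ 2 ∣ p) ∨
       (Even p ∧ Even q ∧ ∃ m : ℕ, m.Prime ∧ Odd m ∧ m ∣ p ∧ m ^ 2 ∣ q) ∨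
       (Even p ∧ Even q ∧ ∃ m : ℕ, m.Prime ∧ Odd m ∧ m ∣ q ∧ m ^ 2 ∣ p) ∨
       (8 ∣ p ∧ 32 ∣ q) ∨
       (8 ∣ q ∧ 32 ∣ p)) := by
  obtain ⟨-, hp, hq, hp2, hq2, hinv, hinter⟩ := hr
  have h : TP a b := by
    refine ⟨hinv, ?_, ht⟩
    intro i j e
    have : a ^ i ∈ Subgroup.zpowers a ⊓ Subgroup.zpowers b := ⟨⟨i, rfl⟩, ⟨j, e.symm⟩⟩
    rw [hinter] at this
    exact this
  have hCC : CC p q := by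
    by_contra hn
    exact hc (TP.main _ G a b rfl h (by rwa [hp, hq]))
  have par1 : Odd p → q ∣ 2 * p := by
    intro ho
    have := parity _ G a b rfl h (by rwa [hp])
    rwa [hp, hq] at this
  have par2 : Odd q → p ∣ 2 * q := by
    intro ho
    have := parity _ G b a rfl h.symm (by rwa [hq])
    rwa [hp, hq] at this
  have hnb : ¬ (Odd p ∧ Odd q) := by
    rintro ⟨o1, o2⟩
    have hcard := h.card
    have ho : orderOf (a * b) ∣ 2 := orderOf_dvd_of_pow_eq_one hinv
    have ho2 := orderOf_dvd_natCard (a * b)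
    rw [hcard, hp, hq] at ho2
    have := Nat.dvd_gcd ho ho2
    rw [(Nat.coprime_two_left.2 (o1.mul o2) : Nat.gcd 2 _ = 1), Nat.dvd_one, orderOf_eq_one_iff] at this
    have e : a ^ (1 : ℤ) = b ^ (-1 : ℤ) := by
      rw [zpow_one, zpow_neg_one]; exact eq_inv_of_mul_eq_one_left this
    have := h.disj _ _ e
    rw [zpow_one] at this
    rw [this, orderOf_one] at hp
    omega
  rcases Nat.even_or_odd p with ep | op
  · rcases Nat.even_or_odd q with eq | oq
    · rcases hCC with h1 | h1 | h1 | h1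
      · exact Or.inr (Or.inr (Or.inl ⟨ep, eq, h1⟩))
      · exact Or.inr (Or.inr (Or.inr (Or.inl ⟨ep, eq, h1⟩)))
      · exact Or.inr (Or.inr (Or.inr (Or.inr (Or.inl h1))))
      · exact Or.inr (Or.inr (Or.inr (Or.inr (Or.inr h1))))
    · refine Or.inl ⟨oq, ep, par2 oq, ?_⟩
      rw [Nat.odd_iff] at oq
      rcases hCC with h1 | ⟨m, hm, hmo, h1, h2⟩ | h1 | h1
      · exact h1
      · refine ⟨m, hm, hmo, ?_, ?_⟩
        · exact (dvd_pow_self m (by norm_num)).trans h2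
        · have : m ^ 2 ∣ 2 * q := h2.trans (par2 (Nat.odd_iff.2 oq))
          exact Nat.Coprime.dvd_of_dvd_mul_left
            (Nat.Coprime.pow_left 2 (Nat.coprime_two_right.2 hmo)) this
      · omega
      · omega
  · have eq : Even q := by
      rw [← Nat.not_odd_iff_even]; exact fun o => hnb ⟨op, o⟩
    refine Or.inr (Or.inl ⟨op, eq, par1 op, ?_⟩)
    rcases hCC with ⟨m, hm, hmo, h1, h2⟩ | h1 | h1 | h1
    · refine ⟨m, hm, hmo, ?_, ?_⟩
      · exact (dvd_pow_self m (by norm_num)).trans h2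
      · have : m ^ 2 ∣ 2 * p := h2.trans (par1 op)
        exact Nat.Coprime.dvd_of_dvd_mul_left
          (Nat.Coprime.pow_left 2 (Nat.coprime_two_right.2 hmo)) this
    · exact h1
    · rw [Nat.odd_iff] at op; omega
    · rw [Nat.odd_iff] at op; omega
/-- existence of a tight chiral pair -/
def Good (p q : ℕ) : Prop :=
  ∃ (G : Type) (instG : Group G) (_ : Finite G) (a b : G),
        @IsRotPair G instG a b p q ∧ @IsTight G instG a b ∧ @IsChiral G instG a b

/-- data in an ambient group -/
structure PreT {G : Type} [Group G] (a b : G) : Prop where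
  inv : (a * b) ^ 2 = 1
  disj : ∀ i j : ℤ, a ^ i = b ^ j → a ^ i = 1
  rel : ∀ i : ℤ, ∃ x y : ℤ, b * a ^ i = a ^ x * b ^ y

/-- strong form of chirality -/
def ChirW {G : Type} [Group G] (a b : G) : Prop :=
  ∃ i : ℤ, ∀ x y : ℤ, b * a ^ i = a ^ x * b ^ y → b⁻¹ * a ^ (-i) ≠ a ^ (-x) * b ^ (-y)

theorem Good.symm {p q : ℕ} (h : Good p q) : Good q p := by
  obtain ⟨G, iG, fG, a, b, ⟨h1, h2, h3, h4, h5, h6, h7⟩, ht, hc⟩ := h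
  refine ⟨G, iG, fG, b, a, ⟨?_, h3, h2, h5, h4, ?_, ?_⟩, ?_, ?_⟩
  · rw [Set.pair_comm]; exact h1
  · rw [pow_two] at h6 ⊢
    have e : b * a * (b * a) = a⁻¹ * (a * b * (a * b)) * a := by group
    rw [e, h6]; group
  · rw [inf_comm]; exact h7
  · intro g
    obtain ⟨i, j, hij⟩ := ht g⁻¹
    refine ⟨-j, -i, ?_⟩
    rw [← inv_inv g, hij]; group
  · intro hr; exact hc (OR_symm hr)

theorem PreT.good {Γ : Type} [Group Γ] [Finite Γ] {a b : Γ} (h : PreT a b) (hc : ChirW a b) {p q : ℕ}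
    (hp : orderOf a = p) (hq : orderOf b = q) (hp2 : 2 ≤ p) (hq2 : 2 ≤ q) : Good p q := by
  let H := Subgroup.closure ({a, b} : Set Γ)
  have ha : a ∈ H := Subgroup.subset_closure (by simp)
  have hb : b ∈ H := Subgroup.subset_closure (by simp)
  have hcl : ∀ g ∈ H, ∃ i j : ℤ, g = a ^ i * b ^ j := by
    have hbn : ∀ (n : ℕ) (i j : ℤ), ∃ x y : ℤ, b ^ n * (a ^ i * b ^ j) = a ^ x * b ^ y := by
      intro n
      induction n with
      | zero => intro i j; exact ⟨i, j, by simp⟩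
      | succ n ih =>
        intro i j
        obtain ⟨x, y, hxy⟩ := h.rel i
        obtain ⟨x', y', hxy'⟩ := ih x (y + j)
        refine ⟨x', y', ?_⟩
        rw [← hxy', zpow_add, pow_succ, ← mul_assoc (a ^ x), ← hxy]; group
    have hbz : ∀ (n i j : ℤ), ∃ x y : ℤ, b ^ n * (a ^ i * b ^ j) = a ^ x * b ^ y := by
      intro n i j
      obtain ⟨m, hm⟩ : b ^ n ∈ Submonoid.powers b := by
        rw [mem_powers_iff_mem_zpowers]; exact ⟨n, rfl⟩
      have hm : b ^ m = b ^ n := hm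
      rw [← hm]; exact hbn m i j
    intro g hg
    induction hg using Subgroup.closure_induction with
    | mem x hx =>
      rcases hx with rfl | hx
      · exact ⟨1, 0, by simp⟩
      · rw [Set.mem_singleton_iff] at hx
        exact ⟨0, 1, by simp [hx]⟩
    | one => exact ⟨0, 0, by simp⟩
    | mul x y _ _ hx hy =>
      obtain ⟨i, j, rfl⟩ := hx
      obtain ⟨i', j', rfl⟩ := hy
      obtain ⟨x, y, hxy⟩ := hbz j i' j'
      exact ⟨i + x, y, by rw [mul_assoc, hxy, zpow_add, mul_assoc]⟩
    | inv x _ hx =>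
      obtain ⟨i, j, rfl⟩ := hx
      obtain ⟨x, y, hxy⟩ := hbz (-j) (-i) 0
      refine ⟨x, y, ?_⟩
      rw [← hxy]; group
  refine ⟨H, inferInstance, inferInstance, ⟨a, ha⟩, ⟨b, hb⟩, ⟨?_, ?_, ?_, hp2, hq2, ?_, ?_⟩, ?_, ?_⟩
  · rw [eq_top_iff]
    have := Subgroup.closure_closure_coe_preimage (k := ({a, b} : Set Γ))
    rw [← this]
    apply Subgroup.closure_mono
    rintro ⟨x, hx⟩ (h1 | h1)
    · left; exact Subtype.ext h1
    · right; exact Subtype.ext h1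
  · rw [Subgroup.orderOf_mk, hp]
  · rw [Subgroup.orderOf_mk, hq]
  · ext; exact h.inv
  · rw [eq_bot_iff]
    rintro ⟨x, hx⟩ ⟨⟨i, hi⟩, ⟨j, hj⟩⟩
    have hi : a ^ i = x := congrArg Subtype.val hi
    have hj : b ^ j = x := congrArg Subtype.val hj
    rw [Subgroup.mem_bot]
    ext
    show x = 1
    rw [← hi]; exact h.disj i j (hi.trans hj.symm)
  · rintro ⟨g, hg⟩
    obtain ⟨i, j, e⟩ := hcl g hg
    exact ⟨i, j, Subtype.ext e⟩
  · intro hr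
    have hr := RegP.of_OR hr
    obtain ⟨i, hi⟩ := hc
    obtain ⟨x, y, hxy⟩ := h.rel i
    exact hi x y hxy (congrArg Subtype.val (hr i x y (Subtype.ext hxy)))

theorem exists_crt {m n : ℕ} (hd : Nat.gcd m n ∣ 2) {x y : ℤ} (h : (2 : ℤ) ∣ x - y) :
    ∃ z : ℤ, (m : ℤ) ∣ z - x ∧ (n : ℤ) ∣ z - y := by
  have h1 : ((Nat.gcd m n : ℕ) : ℤ) ∣ x - y := (Int.natCast_dvd_natCast.2 hd).trans h
  obtain ⟨t, ht⟩ := h1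
  rw [Nat.gcd_eq_gcd_ab] at ht
  refine ⟨x - m * (Nat.gcdA m n * t), ⟨-(Nat.gcdA m n * t), by ring⟩, ⟨Nat.gcdB m n * t, ?_⟩⟩
  linear_combination ht

theorem zpow_eq_of_dvd {G : Type} [Group G] {a : G} {x y : ℤ} (h : (orderOf a : ℤ) ∣ x - y) : a ^ x = a ^ y := by
  rw [orderOf_dvd_iff_zpow_eq_one, zpow_sub, mul_inv_eq_one] at h
  exact h

theorem PreT.prod {G H : Type} [Group G] [Group H] {a b : G} {c d : H} (h1 : PreT a b)
    (hi : (c * d) ^ 2 = 1) (hj : ∀ i j : ℤ, c ^ i = d ^ j → c ^ i = 1)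
    (ho : Nat.gcd (orderOf a) (orderOf c) ∣ 2) (ho' : Nat.gcd (orderOf b) (orderOf d) ∣ 2)
    (hrel : ∀ i : ℤ, ∃ x y x' y' : ℤ, b * a ^ i = a ^ x * b ^ y ∧ d * c ^ i = c ^ x' * d ^ y' ∧
      (2 : ℤ) ∣ x - x' ∧ (2 : ℤ) ∣ y - y') : PreT (a, c) (b, d) := by
  refine ⟨?_, ?_, ?_⟩
  · ext
    · exact h1.inv
    · exact hi
  · intro i j e
    ext
    · exact h1.disj i j (congrArg Prod.fst e)
    · exact hj i j (congrArg Prod.snd e)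
  · intro i
    obtain ⟨x, y, x', y', e1, e2, d1, d2⟩ := hrel i
    obtain ⟨X, hX, hX'⟩ := exists_crt ho d1
    obtain ⟨Y, hY, hY'⟩ := exists_crt ho' d2
    refine ⟨X, Y, ?_⟩
    ext
    · show b * a ^ i = a ^ X * b ^ Y
      rw [e1, zpow_eq_of_dvd hX, zpow_eq_of_dvd hY]
    · show d * c ^ i = c ^ X * d ^ Y
      rw [e2, zpow_eq_of_dvd hX', zpow_eq_of_dvd hY']

theorem ChirW.prod {G H : Type} [Group G] [Group H] {a b : G} (c d : H) (h : ChirW a b) :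
    ChirW (a, c) (b, d) := by
  obtain ⟨i, hi⟩ := h
  exact ⟨i, fun x y e e' => hi x y (congrArg Prod.fst e) (congrArg Prod.fst e')⟩
/-- the map `i ↦ -i - w i (i-1)` -/
def bfun {R : Type} [CommRing R] (W : R) (i : R) : R := -i - W * (i * (i - 1))

theorem zmod_even (P : ℕ) (i : ZMod P) : ∃ Y : ZMod P, i * (i - 1) = 2 * Y := by
  obtain ⟨k, rfl⟩ := ZMod.intCast_surjective i
  obtain ⟨y, hy⟩ := (Int.even_mul_pred_self k).two_dvd
  exact ⟨y, by exact_mod_cast congrArg (Int.cast : ℤ → ZMod P) hy⟩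

theorem bfun_sq {P : ℕ} {W : ZMod P} (hw : 2 * W ^ 2 = 0) (i : ZMod P) :
    bfun W (bfun W i) = (1 - 2 * W) * i := by
  obtain ⟨Y, hX⟩ := zmod_even P i
  unfold bfun
  linear_combination (-(W^2)*(2*i+1) - W^3*(i*(i-1)))*hX + (-(Y*(2*i+1)) - W*Y*(i*(i-1)))*hw

theorem bfun_bij {P : ℕ} [NeZero P] {W : ZMod P} (hw : 2 * W ^ 2 = 0) : Function.Bijective (bfun W) := by
  rw [← Finite.injective_iff_bijective]
  intro i j e
  have e := congrArg (bfun W) e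
  rw [bfun_sq hw, bfun_sq hw] at e
  linear_combination (1 + 2 * W) * e + (2 * i - 2 * j) * hw

theorem core1 (P w r N n : ℕ) [NeZero P] [NeZero n] (hN : 0 < N) (hP : P = w * r) (hNw : N ∣ w)
    (hr : r ∣ 2 * N) (hr2 : ∀ j : ℤ, (r : ℤ) ∣ 2 * j → (N : ℤ) ∣ j) (hr4 : ¬ r ∣ 4) (hn : n ∣ P) :
    ∃ (G : Type) (_ : Group G) (_ : Finite G) (a b : G), PreT a b ∧ ChirW a b ∧ orderOf a = P ∧
      orderOf b = Nat.lcm (2 * N) n ∧ ∀ i : ℤ, b * a ^ i =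
        a ^ (-i - w * (i * (i - 1))) * b ^ (1 - 2 * i - w * (i * (i - 1))) := by
  have hP0 : P ≠ 0 := NeZero.ne P
  have hw0 : 0 < w := by
    rcases Nat.eq_zero_or_pos w with e | e
    · rw [e, zero_mul] at hP; exact absurd hP hP0
    · exact e
  set W : ZMod P := (w : ZMod P) with hW
  have hcast : ∀ k : ℤ, (k : ZMod P) = 0 ↔ (P : ℤ) ∣ k := fun k => ZMod.intCast_zmod_eq_zero_iff_dvd k P
  have hdv : ∀ k : ℤ, (P : ℤ) ∣ w * k ↔ (r : ℤ) ∣ k := by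
    intro k
    rw [hP]; push_cast
    exact mul_dvd_mul_iff_left (by exact_mod_cast hw0.ne')
  have hw : 2 * W ^ 2 = 0 := by
    have : ((w * (2 * w) : ℤ) : ZMod P) = 0 := by
      rw [hcast, hdv]
      have : r ∣ 2 * w := hr.trans (Nat.mul_dvd_mul_left 2 hNw)
      exact_mod_cast this
    push_cast at this
    rw [hW]; linear_combination this
  have h4 : 4 * W ≠ 0 := by
    intro e
    have : ((w * 4 : ℤ) : ZMod P) = 0 := by push_cast; rw [← hW]; linear_combination e
    rw [hcast, hdv] at this
    exact hr4 (by exact_mod_cast this)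
  have h2 : 2 * W ≠ 0 := fun e => h4 (by linear_combination 2 * e)
  have hWj : ∀ j : ℤ, 2 * W * j = 0 → (N : ℤ) ∣ j := by
    intro j e
    have : ((w * (2 * j) : ℤ) : ZMod P) = 0 := by push_cast; rw [← hW]; linear_combination e
    rw [hcast, hdv] at this
    exact hr2 j this
  have hWN : 2 * W * N = 0 := by
    have : ((w * (2 * N) : ℤ) : ZMod P) = 0 := by
      rw [hcast, hdv]; exact_mod_cast hr
    push_cast at this
    rw [hW]; linear_combination this
  let τ : Equiv.Perm (ZMod P) := Equiv.addRight 1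
  let β : Equiv.Perm (ZMod P) := Equiv.ofBijective _ (bfun_bij hw)
  have hβ : ∀ j, β j = bfun W j := fun j => rfl
  have hτn : ∀ (i : ℕ) (j : ZMod P), (τ ^ i) j = j + i := by
    intro i
    induction i with
    | zero => intro j; simp
    | succ i ih =>
      intro j
      rw [pow_succ, Equiv.Perm.mul_apply, ih]
      show j + 1 + i = _
      push_cast; ring
  have hτ : ∀ (i : ℤ) (j : ZMod P), (τ ^ i) j = j + i := by
    intro i j
    obtain ⟨k, rfl | rfl⟩ := i.eq_nat_or_neg
    · rw [zpow_natCast, hτn]; simp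
    · rw [zpow_neg, zpow_natCast, Equiv.Perm.inv_eq_iff_eq, hτn]; push_cast; ring
  have hβn : ∀ (k : ℕ) (j : ZMod P), (β ^ (2 * k)) j = (1 - 2 * W * k) * j := by
    intro k
    induction k with
    | zero => intro j; simp
    | succ k ih =>
      intro j
      rw [show 2 * (k + 1) = 2 * k + 1 + 1 by ring, pow_succ, pow_succ, Equiv.Perm.mul_apply,
        Equiv.Perm.mul_apply, ih, hβ, hβ, bfun_sq hw]
      push_cast
      linear_combination (2 * k * j) * hw
  have hβz : ∀ (k : ℤ) (j : ZMod P), (β ^ (2 * k)) j = (1 - 2 * W * k) * j := by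
    intro i j
    obtain ⟨k, rfl | rfl⟩ := i.eq_nat_or_neg
    · have := hβn k j
      rw [← zpow_natCast] at this
      push_cast at this ⊢
      exact this
    · have e : β ^ (2 * -(k : ℤ)) = (β ^ (2 * k))⁻¹ := by
        rw [mul_neg, zpow_neg, ← zpow_natCast]; push_cast; rfl
      rw [e, Equiv.Perm.inv_eq_iff_eq, hβn]; push_cast
      linear_combination (2 * k ^ 2 * j) * hw
  have hβodd : ∀ (k : ℤ) (j : ZMod P), (β ^ (2 * k + 1)) j = (1 - 2 * W * k) * bfun W j := by
    intro k j
    rw [zpow_add, zpow_one, Equiv.Perm.mul_apply, hβz, hβ]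
  have hβodd' : ∀ (k : ℤ) (j : ZMod P), (β ^ (1 - 2 * k)) j = bfun W ((1 + 2 * W * k) * j) := by
    intro k j
    rw [show 1 - 2 * k = 1 + 2 * (-k) by ring, zpow_add, zpow_one, Equiv.Perm.mul_apply, hβz, hβ]
    congr 1; push_cast; ring
  have hβ0 : ∀ k : ℤ, (β ^ k) 0 = 0 := by
    intro k
    have hf : β 0 = 0 := by rw [hβ]; simp [bfun]
    exact Equiv.Perm.zpow_apply_eq_self_of_apply_eq_self hf k
  have hoτ : orderOf τ = P := by
    apply Nat.dvd_antisymm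
    · apply orderOf_dvd_of_pow_eq_one
      ext1 j
      rw [hτn]; simp
    · have := congrArg (fun f : Equiv.Perm (ZMod P) => f 0) (pow_orderOf_eq_one τ)
      simp only [hτn, zero_add, Equiv.Perm.one_apply] at this
      exact (ZMod.natCast_eq_zero_iff _ _).1 this
  have hβ1 : ∀ k : ℤ, β ^ k = 1 → ((2 * N : ℕ) : ℤ) ∣ k := by
    intro k hk
    rcases Int.even_or_odd' k with ⟨l, rfl | rfl⟩
    · have := hβz l 1
      rw [hk, Equiv.Perm.one_apply] at this
      obtain ⟨t, rfl⟩ := hWj l (by linear_combination this)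
      exact ⟨t, by push_cast; ring⟩
    · exfalso
      have e1 := hβodd l 1
      have e2 := hβodd l (-1)
      rw [hk, Equiv.Perm.one_apply] at e1 e2
      unfold bfun at e1 e2
      apply h2
      linear_combination e1 + e2 + (2 * l) * hw
  have hoβ : orderOf β = 2 * N := by
    apply Nat.dvd_antisymm
    · apply orderOf_dvd_of_pow_eq_one
      ext1 j
      rw [hβn, Equiv.Perm.one_apply]
      linear_combination -j * hWN
    · have := hβ1 (orderOf β) (by rw [zpow_natCast, pow_orderOf_eq_one])
      exact_mod_cast this
  have hrel : ∀ i : ℤ, β * τ ^ i = τ ^ (-i - w * (i * (i - 1))) * β ^ (1 - 2 * i - w * (i * (i - 1))) := by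
    intro i
    have e : β ^ (1 - 2 * i - w * (i * (i - 1))) = β ^ (1 - 2 * i) := by
      apply zpow_eq_of_dvd
      rw [hoβ]
      obtain ⟨y, hy⟩ := (Int.even_mul_pred_self i).two_dvd
      obtain ⟨v, hv⟩ := hNw
      refine ⟨-(v * y), ?_⟩
      rw [hy, hv]; push_cast; ring
    rw [e]
    ext1 j
    rw [Equiv.Perm.mul_apply, Equiv.Perm.mul_apply, hτ, hτ, hβ, hβodd']
    unfold bfun
    push_cast
    linear_combination (i * j^2 * (2 + 2 * W * i) - i * j) * hw
  have hinv : (τ * β) ^ 2 = 1 := by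
    ext1 j
    obtain ⟨Y, hX⟩ := zmod_even P j
    rw [pow_two, Equiv.Perm.mul_apply, Equiv.Perm.mul_apply, Equiv.Perm.mul_apply, Equiv.Perm.one_apply, hβ, hβ]
    show bfun W (bfun W j + 1) + 1 = j
    unfold bfun
    linear_combination (-(W^2)*(2*j-1) - W^3*(j*(j-1)))*hX + (-(Y*(2*j-1)) - W*Y*(j*(j-1)))*hw
  let z : Multiplicative (ZMod n) := Multiplicative.ofAdd 1
  have hoz : orderOf z = n := by
    rw [orderOf_ofAdd_eq_addOrderOf, ZMod.addOrderOf_one]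
  have hREL : ∀ i : ℤ, ((β, z⁻¹) : Equiv.Perm (ZMod P) × Multiplicative (ZMod n)) * (τ, z) ^ i =
        (τ, z) ^ (-i - w * (i * (i - 1))) * (β, z⁻¹) ^ (1 - 2 * i - w * (i * (i - 1))) := by
    intro i
    apply Prod.ext
    · exact hrel i
    · show z⁻¹ * z ^ i = z ^ (-i - w * (i * (i - 1))) * z⁻¹ ^ (1 - 2 * i - w * (i * (i - 1)))
      rw [inv_zpow', ← zpow_neg_one, ← zpow_add, ← zpow_add]
      congr 1; ring
  refine ⟨Equiv.Perm (ZMod P) × Multiplicative (ZMod n), inferInstance, inferInstance, (τ, z), (β, z⁻¹),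
    ⟨?_, ?_, ?_⟩, ?_, ?_, ?_, hREL⟩
  · apply Prod.ext
    · exact hinv
    · show (z * z⁻¹) ^ 2 = 1
      simp
  · intro i j e
    have e1 : τ ^ i = β ^ j := congrArg Prod.fst e
    have e2 := congrArg (fun f : Equiv.Perm (ZMod P) => f 0) e1
    simp only [hτ, hβ0, zero_add] at e2
    rw [hcast] at e2
    apply Prod.ext
    · show τ ^ i = 1
      rw [← orderOf_dvd_iff_zpow_eq_one, hoτ]; exact e2
    · show z ^ i = 1
      rw [← orderOf_dvd_iff_zpow_eq_one, hoz]
      exact (Int.natCast_dvd_natCast.2 hn).trans e2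
  · intro i; exact ⟨_, _, hREL i⟩
  · refine ⟨2, fun x y e e' => ?_⟩
    have e1 : β * τ ^ (2 : ℤ) = τ ^ x * β ^ y := congrArg Prod.fst e
    have e2 : β⁻¹ * τ ^ (-2 : ℤ) = τ ^ (-x) * β ^ (-y) := congrArg Prod.fst e'
    have f1 := congrArg (fun f : Equiv.Perm (ZMod P) => f 0) e1
    have f2 := congrArg (fun f : Equiv.Perm (ZMod P) => f 0) e2
    simp only [Equiv.Perm.mul_apply, hτ, hβ0, zero_add] at f1 f2
    rw [Equiv.Perm.inv_eq_iff_eq, hβ] at f2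
    rw [hβ] at f1
    push_cast at f1 f2
    rw [← f1] at f2
    unfold bfun at f2
    apply h4
    linear_combination f2 - (3 + 2 * W) * hw
  · rw [Prod.orderOf, hoτ, hoz]
    exact Nat.lcm_eq_left hn
  · rw [Prod.orderOf, hoβ, orderOf_inv, hoz]

theorem lcm_eq_of (x y z k : ℕ) (h : x * y = z * k) (hg : Nat.gcd x y = k) (hk : 0 < k) : Nat.lcm x y = z := by
  have := Nat.gcd_mul_lcm x y
  rw [hg, h, mul_comm z k] at this
  exact Nat.eq_of_mul_eq_mul_left hk this

theorem dihedral_factor (p2 q2 : ℕ) [NeZero p2] [NeZero q2] (hp : 2 ∣ p2) (hq : 2 ∣ q2) :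
    ∃ (H : Type) (_ : Group H) (_ : Finite H) (c d : H), (c * d) ^ 2 = 1 ∧
      (∀ i j : ℤ, c ^ i = d ^ j → c ^ i = 1) ∧ orderOf c = p2 ∧ orderOf d = q2 ∧
      ∀ i : ℤ, ∃ y' : ℤ, d * c ^ i = c ^ (-i) * d ^ y' ∧ (2 : ℤ) ∣ y' - 1 := by
  have hsq : ∀ (n : ℕ) (i : ℤ), (DihedralGroup.sr 0 : DihedralGroup n) ^ (2 * i) = 1 := by
    intro n i
    rw [zpow_mul]
    have : (DihedralGroup.sr 0 : DihedralGroup n) ^ (2 : ℤ) = 1 := by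
      rw [zpow_two]; exact DihedralGroup.sr_mul_self 0
    rw [this, one_zpow]
  have hsq' : ∀ (n : ℕ) (i : ℤ), (DihedralGroup.sr 0 : DihedralGroup n) ^ (2 * i + 1) = DihedralGroup.sr 0 := by
    intro n i
    rw [zpow_add, hsq]; simp
  refine ⟨DihedralGroup p2 × DihedralGroup q2, inferInstance, inferInstance,
    (DihedralGroup.r 1, DihedralGroup.sr 0), (DihedralGroup.sr 0, DihedralGroup.r 1), ?_, ?_, ?_, ?_, ?_⟩
  · rw [pow_two]
    ext1
    · simp only [Prod.fst_mul, Prod.fst_one, DihedralGroup.r_mul_sr, DihedralGroup.sr_mul_self]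
    · simp only [Prod.snd_mul, Prod.snd_one, DihedralGroup.sr_mul_r, DihedralGroup.sr_mul_self]
  · intro i j h
    have h1 := congrArg Prod.fst h
    have h2 := congrArg Prod.snd h
    simp only [Prod.pow_fst, Prod.pow_snd] at h1 h2
    rw [DihedralGroup.r_one_zpow] at h1 h2
    ext1
    · simp only [Prod.pow_fst, Prod.fst_one, DihedralGroup.r_one_zpow]
      rcases Int.even_or_odd' j with ⟨l, rfl | rfl⟩
      · rw [h1, hsq]
      · rw [hsq'] at h1; cases h1
    · simp only [Prod.pow_snd, Prod.snd_one]
      rcases Int.even_or_odd' i with ⟨l, rfl | rfl⟩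
      · rw [hsq]
      · rw [hsq'] at h2; cases h2
  · rw [Prod.orderOf]
    simp only [DihedralGroup.orderOf_r_one, DihedralGroup.orderOf_sr]
    exact Nat.lcm_eq_left hp
  · rw [Prod.orderOf]
    simp only [DihedralGroup.orderOf_r_one, DihedralGroup.orderOf_sr]
    exact Nat.lcm_eq_right hq
  · intro i
    rcases Int.even_or_odd' i with ⟨l, rfl | rfl⟩
    · refine ⟨1, ?_, by norm_num⟩
      ext1
      · simp only [Prod.fst_mul, Prod.pow_fst, DihedralGroup.r_one_zpow, zpow_one,
          DihedralGroup.sr_mul_r, DihedralGroup.r_mul_sr]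
        congr 1; push_cast; ring
      · have e : -(2 * l) = 2 * (-l) := by ring
        simp only [Prod.snd_mul, Prod.pow_snd, e, hsq]
        simp
    · refine ⟨-1, ?_, by norm_num⟩
      ext1
      · simp only [Prod.fst_mul, Prod.pow_fst, DihedralGroup.r_one_zpow, zpow_neg_one,
          DihedralGroup.sr_mul_r, DihedralGroup.r_mul_sr, DihedralGroup.inv_sr]
        congr 1; push_cast; ring
      · have e : -(2 * l + 1) = 2 * (-l - 1) + 1 := by ring
        simp only [Prod.snd_mul, Prod.pow_snd, e, hsq']
        simp

theorem combine (P w r N n p2 q2 p q : ℕ) [NeZero P] [NeZero n] [NeZero p2] [NeZero q2]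
    (hN : 0 < N) (hP : P = w * r) (hNw : N ∣ w) (hr : r ∣ 2 * N)
    (hr2 : ∀ j : ℤ, (r : ℤ) ∣ 2 * j → (N : ℤ) ∣ j) (hr4 : ¬ r ∣ 4) (hn : n ∣ P)
    (h1 : 2 ∣ p2) (h2 : 2 ∣ q2) (g1 : Nat.gcd P p2 ∣ 2) (g2 : Nat.gcd (Nat.lcm (2 * N) n) q2 ∣ 2)
    (hp : Nat.lcm P p2 = p) (hq : Nat.lcm (Nat.lcm (2 * N) n) q2 = q)
    (hp2 : 2 ≤ p) (hq2 : 2 ≤ q) : Good p q := by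
  obtain ⟨G, iG, fG, a, b, hpre, hch, oa, ob, hrel⟩ := core1 P w r N n hN hP hNw hr hr2 hr4 hn
  obtain ⟨H, iH, fH, c, d, hi, hj, oc, od, hrel'⟩ := dihedral_factor p2 q2 h1 h2
  have := hpre.prod hi hj (by rw [oa, oc]; exact g1) (by rw [ob, od]; exact g2) (by
    intro i
    obtain ⟨y', e, hy⟩ := hrel' i
    have hev : (2 : ℤ) ∣ i * (i - 1) := by
      have := Int.even_mul_succ_self (i - 1)
      rw [even_iff_two_dvd] at this
      have e' : i * (i - 1) = (i - 1) * (i - 1 + 1) := by ring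
      rw [e']; exact this
    obtain ⟨s, hs⟩ := hev
    obtain ⟨t, ht⟩ := hy
    refine ⟨_, _, _, _, hrel i, e, ⟨-(w * s), ?_⟩, ⟨-i - w * s - t, ?_⟩⟩
    · rw [hs]; ring
    · rw [hs]; linear_combination -ht)
  refine this.good (hch.prod c d) ?_ ?_ hp2 hq2
  · rw [Prod.orderOf]; simp only [oa, oc]; exact hp
  · rw [Prod.orderOf]; simp only [ob, od]; exact hq

theorem odd_r2 (m : ℕ) (hm : Odd m) (j : ℤ) (h : (m : ℤ) ∣ 2 * j) : (m : ℤ) ∣ j := by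
  have hc : IsCoprime (m : ℤ) 2 := by
    have := (Nat.coprime_two_right.2 hm).isCoprime
    exact_mod_cast this
  exact hc.dvd_of_dvd_mul_left h

theorem odd_r4 (m : ℕ) (hm : Odd m) (hm1 : m.Prime) : ¬ m ∣ 4 := by
  intro h
  have : m ∣ 2 ^ 2 := by simpa using h
  have := hm1.dvd_of_dvd_pow this
  rw [Nat.prime_dvd_prime_iff_eq hm1 Nat.prime_two] at this
  subst this
  exact absurd hm (by decide)

theorem good_case2 {p q : ℕ} (hp : 2 ≤ p) (hq : 2 ≤ q) (ho : Odd p) (he : Even q) (hd : q ∣ 2 * p)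
    (m : ℕ) (hm : m.Prime) (hmo : Odd m) (hmq : m ∣ q) (hmp : m ^ 2 ∣ p) : Good p q := by
  obtain ⟨n, rfl⟩ := even_iff_two_dvd.1 he
  have hn : n ∣ p := Nat.dvd_of_mul_dvd_mul_left (by norm_num) hd
  have hmn : m ∣ n := (Nat.Coprime.dvd_mul_left (Nat.coprime_two_right.2 hmo)).1 hmq
  obtain ⟨k, rfl⟩ := hmp
  have : NeZero (m ^ 2 * k) := ⟨by omega⟩
  have : NeZero n := ⟨by omega⟩
  obtain ⟨G, iG, fG, a, b, hpre, hch, oa, ob, -⟩ := core1 (m ^ 2 * k) (m * k) m m n hm.pos (by ring)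
    (Dvd.intro _ rfl) (Dvd.intro_left _ rfl) (odd_r2 m hmo) (odd_r4 m hmo hm) hn
  refine hpre.good hch oa ?_ hp hq
  rw [ob]
  have hno : Odd n := ho.of_dvd_nat hn
  apply Nat.dvd_antisymm
  · exact Nat.lcm_dvd (Nat.mul_dvd_mul_left 2 hmn) (Dvd.intro_left _ rfl)
  · exact (Nat.Coprime.mul_dvd_of_dvd_of_dvd (Nat.coprime_two_left.2 hno)
      ((Dvd.intro _ rfl : 2 ∣ 2 * m).trans (Nat.dvd_lcm_left _ _)) (Nat.dvd_lcm_right _ _))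

theorem good_case4_aux (m α β p q : ℕ) (hm : m.Prime) (hmo : Odd m) (hp : 2 ∣ p) (hq : 2 ∣ q)
    (hp0 : p ≠ 0) (hq0 : q ≠ 0) (hmp : ¬ m ∣ p) (hmq : ¬ m ∣ q) (hβ : 1 ≤ β) (hα : 2 ≤ α) (hle : β ≤ α) :
    Good (m ^ α * p) (m ^ β * q) := by
  have : NeZero p := ⟨hp0⟩
  have : NeZero q := ⟨hq0⟩
  have : NeZero (m ^ α) := ⟨pow_ne_zero _ hm.ne_zero⟩
  have : NeZero (m ^ β) := ⟨pow_ne_zero _ hm.ne_zero⟩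
  have c2 : Nat.Coprime 2 (m ^ β) := Nat.coprime_two_left.2 hmo.pow
  have cp : Nat.Coprime (m ^ α) p := ((Nat.Prime.coprime_iff_not_dvd hm).2 hmp).pow_left _
  have cq : Nat.Coprime (m ^ β) q := ((Nat.Prime.coprime_iff_not_dvd hm).2 hmq).pow_left _
  have hl : Nat.lcm (2 * m) (m ^ β) = 2 * m ^ β := by
    apply Nat.dvd_antisymm
    · exact Nat.lcm_dvd (Nat.mul_dvd_mul_left 2 (dvd_pow_self m (by omega))) (Dvd.intro_left _ rfl)
    · exact c2.mul_dvd_of_dvd_of_dvd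
        ((Dvd.intro _ rfl : 2 ∣ 2 * m).trans (Nat.dvd_lcm_left _ _)) (Nat.dvd_lcm_right _ _)
  have hg : Nat.gcd (2 * m ^ β) q = 2 := by
    rw [Nat.Coprime.gcd_mul_right_cancel 2 cq]
    exact Nat.gcd_eq_left hq
  refine combine (m ^ α) (m ^ (α - 1)) m m (m ^ β) p q _ _ hm.pos ?_ (dvd_pow_self m (by omega))
    (Dvd.intro_left _ rfl) (odd_r2 m hmo) (odd_r4 m hmo hm) (pow_dvd_pow m hle) hp hq ?_ ?_ ?_ ?_ ?_ ?_
  · rw [← pow_succ]; congr 1; omega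
  · rw [cp.gcd_eq_one]; norm_num
  · rw [hl, hg]
  · exact cp.lcm_eq_mul
  · rw [hl]; exact lcm_eq_of _ _ _ 2 (by ring) hg (by norm_num)
  · exact (Nat.le_of_dvd (Nat.pos_of_ne_zero hp0) hp).trans (Nat.le_mul_of_pos_left _ (pow_pos hm.pos _))
  · exact (Nat.le_of_dvd (Nat.pos_of_ne_zero hq0) hq).trans (Nat.le_mul_of_pos_left _ (pow_pos hm.pos _))

theorem good_case4 {p q : ℕ} (hp : 2 ≤ p) (hq : 2 ≤ q) (ho : Even p) (he : Even q)
    (m : ℕ) (hm : m.Prime) (hmo : Odd m) (hmq : m ∣ q) (hmp : m ^ 2 ∣ p) : Good p q := by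
  obtain ⟨α, p', hp', rfl⟩ := Nat.exists_eq_pow_mul_and_not_dvd (n := p) (by omega) m hm.ne_one
  obtain ⟨β, q', hq', rfl⟩ := Nat.exists_eq_pow_mul_and_not_dvd (n := q) (by omega) m hm.ne_one
  have hα : 2 ≤ α := by
    have h : m ^ 2 ∣ m ^ α := (((Nat.Prime.coprime_iff_not_dvd hm).2 hp').pow_left 2).dvd_of_dvd_mul_right hmp
    exact (Nat.pow_dvd_pow_iff_le_right hm.one_lt).1 h
  have hβ : 1 ≤ β := by
    by_contra h
    have : β = 0 := by omega
    subst this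
    simp at hmq; exact hq' hmq
  have c : ∀ k, Nat.Coprime 2 (m ^ k) := fun k => Nat.coprime_two_left.2 hmo.pow
  have e1 : 2 ∣ p' := (c α).dvd_of_dvd_mul_left (even_iff_two_dvd.1 ho)
  have e2 : 2 ∣ q' := (c β).dvd_of_dvd_mul_left (even_iff_two_dvd.1 he)
  have z1 : p' ≠ 0 := by rintro rfl; simp at hp'
  have z2 : q' ≠ 0 := by rintro rfl; simp at hq'
  rcases le_total β α with h | h
  · exact good_case4_aux m α β p' q' hm hmo e1 e2 z1 z2 hp' hq' hβ hα h
  · exact (good_case4_aux m β α q' p' hm hmo e2 e1 z2 z1 hq' hp' (by omega) (by omega) h).symm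

theorem good_case6_aux (f e p q : ℕ) (hp : Odd p) (hq : Odd q) (he : 3 ≤ e) (hf : 5 ≤ f) (hle : e ≤ f) :
    Good (2 ^ f * p) (2 ^ e * q) := by
  have hp0 : p ≠ 0 := by rintro rfl; simp at hp
  have hq0 : q ≠ 0 := by rintro rfl; simp at hq
  have : NeZero (2 * p) := ⟨by omega⟩
  have : NeZero (2 * q) := ⟨by omega⟩
  have hl : Nat.lcm (2 * 4) (2 ^ e) = 2 ^ e := Nat.lcm_eq_right (pow_dvd_pow 2 he : 2 ^ 3 ∣ 2 ^ e)
  have hg : ∀ k x : ℕ, Odd x → 1 ≤ k → Nat.gcd (2 ^ k) (2 * x) = 2 := by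
    intro k x hx hk
    have : Nat.Coprime (2 ^ k) x := (Nat.coprime_two_left.2 hx).pow_left k
    rw [this.symm.gcd_mul_right_cancel_right 2]
    exact Nat.gcd_eq_right (dvd_pow_self 2 (by omega))
  have h2 : ∀ k x : ℕ, x ≠ 0 → 1 ≤ k → 2 ≤ 2 ^ k * x := by
    intro k x hx hk
    exact (Nat.le_self_pow (by omega) 2).trans (Nat.le_mul_of_pos_right _ (Nat.pos_of_ne_zero hx))
  refine combine (2 ^ f) (2 ^ (f - 3)) 8 4 (2 ^ e) (2 * p) (2 * q) _ _ (by norm_num) ?_ ?_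
    (by norm_num) ?_ (by norm_num) (pow_dvd_pow 2 hle) (Dvd.intro _ rfl) (Dvd.intro _ rfl) ?_ ?_ ?_ ?_
    (h2 _ _ hp0 (by omega)) (h2 _ _ hq0 (by omega))
  · rw [show 8 = 2 ^ 3 by norm_num, ← pow_add]; congr 1; omega
  · exact (pow_dvd_pow 2 (by omega) : 2 ^ 2 ∣ 2 ^ (f - 3))
  · intro j hj; push_cast at *; omega
  · rw [hg f p hp (by omega)]
  · rw [hl, hg e q hq (by omega)]
  · exact lcm_eq_of _ _ _ 2 (by ring) (hg f p hp (by omega)) (by norm_num)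
  · rw [hl]; exact lcm_eq_of _ _ _ 2 (by ring) (hg e q hq (by omega)) (by norm_num)

theorem good_case6 {p q : ℕ} (hp : 2 ≤ p) (hq : 2 ≤ q) (h8 : 8 ∣ q) (h32 : 32 ∣ p) : Good p q := by
  obtain ⟨α, p', hp', rfl⟩ := Nat.exists_eq_pow_mul_and_not_dvd (n := p) (by omega) 2 (by norm_num)
  obtain ⟨β, q', hq', rfl⟩ := Nat.exists_eq_pow_mul_and_not_dvd (n := q) (by omega) 2 (by norm_num)
  have key : ∀ k l x : ℕ, ¬ 2 ∣ x → 2 ^ k ∣ 2 ^ l * x → k ≤ l := by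
    intro k l x hx h
    have h : 2 ^ k ∣ 2 ^ l :=
      (((Nat.Prime.coprime_iff_not_dvd Nat.prime_two).2 hx).pow_left k).dvd_of_dvd_mul_right h
    exact (Nat.pow_dvd_pow_iff_le_right (by norm_num)).1 h
  have hα := key 5 α p' hp' h32
  have hβ := key 3 β q' hq' h8
  have o1 : Odd p' := by rw [← Nat.not_even_iff_odd, even_iff_two_dvd]; exact hp'
  have o2 : Odd q' := by rw [← Nat.not_even_iff_odd, even_iff_two_dvd]; exact hq'
  rcases le_total β α with h | h
  · exact good_case6_aux α β p' q' o1 o2 hβ hα h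
  · exact (good_case6_aux β α q' p' o2 o1 (by omega) (by omega) h).symm

/-- Characterization of the Schläfli symbols of tight chiral polyhedra. -/
theorem tight_chiral_schlafli_characterization (p q : ℕ) (hp : 2 ≤ p) (hq : 2 ≤ q) :
    (∃ (G : Type) (instG : Group G) (_ : Finite G) (a b : G),
        @IsRotPair G instG a b p q ∧ @IsTight G instG a b ∧ @IsChiral G instG a b) ↔
      ((Odd q ∧ Even p ∧ p ∣ 2 * q ∧ ∃ m : ℕ, m.Prime ∧ Odd m ∧ m ∣ p ∧ m ^ 2 ∣ q) ∨
       (Odd p ∧ Even q ∧ q ∣ 2 * p ∧ ∃ m : ℕ, m.Prime ∧ Odd m ∧ m ∣ q ∧ m ^ 2 ∣ p) ∨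
       (Even p ∧ Even q ∧ ∃ m : ℕ, m.Prime ∧ Odd m ∧ m ∣ p ∧ m ^ 2 ∣ q) ∨
       (Even p ∧ Even q ∧ ∃ m : ℕ, m.Prime ∧ Odd m ∧ m ∣ q ∧ m ^ 2 ∣ p) ∨
       (8 ∣ p ∧ 32 ∣ q) ∨
       (8 ∣ q ∧ 32 ∣ p)) := by
  constructor
  · rintro ⟨G, iG, fG, a, b, h1, h2, h3⟩
    exact necessity h1 h2 h3
  · rintro (⟨h1, h2, h3, m, hm, h4, h5, h6⟩ | ⟨h1, h2, h3, m, hm, h4, h5, h6⟩ | ⟨h1, h2, m, hm, h4, h5, h6⟩ |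
      ⟨h1, h2, m, hm, h4, h5, h6⟩ | ⟨h1, h2⟩ | ⟨h1, h2⟩)
    · exact (good_case2 hq hp h1 h2 h3 m hm h4 h5 h6).symm
    · exact good_case2 hp hq h1 h2 h3 m hm h4 h5 h6
    · exact (good_case4 hq hp h2 h1 m hm h4 h5 h6).symm
    · exact good_case4 hp hq h1 h2 m hm h4 h5 h6
    · exact (good_case6 hq hp h1 h2).symm
    · exact good_case6 hp hq h1 h2
end

section
/- Let (G, a, b) be a tight chiral rotation pair of type (p, q) with q odd. Then p is even and p divides 2q. Furthermore, if the subgroup Subgroup.zpowers b is core-free in G, then p = 2q. -/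
universe u

/-- In a finite cyclic group, elements of equal order generate each other. -/
lemma tco_mem_of_order {G : Type*} [Group G] [Finite G] {y v w : G}
    (hv : v ∈ Subgroup.zpowers y) (hw : w ∈ Subgroup.zpowers y)
    (h : orderOf w = orderOf v) : w ∈ Subgroup.zpowers v := by
  rw [← mem_powers_iff_mem_zpowers] at hv hw
  obtain ⟨m, rfl⟩ := hv
  obtain ⟨l, rfl⟩ := hw
  simp only at h ⊢
  rw [orderOf_pow, orderOf_pow] at h
  have hq : 0 < orderOf y := orderOf_pos y
  have hg : (orderOf y).gcd l = (orderOf y).gcd m := by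
    have h1 := Nat.div_mul_cancel (Nat.gcd_dvd_left (orderOf y) l)
    have h2 := Nat.div_mul_cancel (Nat.gcd_dvd_left (orderOf y) m)
    rw [h] at h1
    have h3 : 0 < orderOf y / (orderOf y).gcd m :=
      Nat.div_pos (Nat.le_of_dvd hq (Nat.gcd_dvd_left _ _)) (Nat.gcd_pos_of_pos_left _ hq)
    exact Nat.eq_of_mul_eq_mul_left h3 (h1.trans h2.symm)
  have hmem : y ^ ((orderOf y).gcd m) ∈ Subgroup.zpowers (y ^ m) := by
    have hb := Nat.gcd_eq_gcd_ab (orderOf y) m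
    rw [← zpow_natCast y ((orderOf y).gcd m), hb, zpow_add, zpow_mul, zpow_mul, zpow_natCast, zpow_natCast,
      pow_orderOf_eq_one, one_zpow, one_mul]
    exact Subgroup.zpow_mem_zpowers _ _
  obtain ⟨c, hc⟩ := hg ▸ Nat.gcd_dvd_right (orderOf y) l
  rw [hc, pow_mul]
  exact Subgroup.pow_mem _ hmem _

/-- A large cyclic subgroup contains a nontrivial subgroup normalised by a given element. -/
lemma tco_large {H : Type*} [Group H] [Finite H] (x y : H)
    (hc : Nat.card H < orderOf y * orderOf y) :
    ∃ u ∈ Subgroup.zpowers y, u ≠ 1 ∧ x * u * x⁻¹ ∈ Subgroup.zpowers u := by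
  let f : Subgroup.zpowers y × Subgroup.zpowers y → H :=
    fun s => (s.1 : H) * (x * (s.2 : H) * x⁻¹)
  have hf : ¬ Function.Injective f := by
    intro hf
    have := Nat.card_le_card_of_injective f hf
    rw [Nat.card_prod, Nat.card_zpowers] at this
    omega
  simp only [Function.Injective, not_forall] at hf
  obtain ⟨⟨⟨s, hs⟩, ⟨t, ht⟩⟩, ⟨⟨s', hs'⟩, ⟨t', ht'⟩⟩, heq, hne⟩ := hf
  simp only [f] at heq
  have hw : x * (t' * t⁻¹) * x⁻¹ = s'⁻¹ * s := by
    have h1 : s = s' * (x * t' * x⁻¹) * (x * t * x⁻¹)⁻¹ := by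
      rw [← heq]; group
    rw [h1]; group
  have hvm : t' * t⁻¹ ∈ Subgroup.zpowers y := mul_mem ht' (inv_mem ht)
  refine ⟨t' * t⁻¹, hvm, ?_, ?_⟩
  · intro h1
    apply hne
    have ht1 : t' = t := by rwa [mul_inv_eq_one] at h1
    rw [h1] at hw
    have hs1 : s' = s := by
      rw [← inv_mul_eq_one, ← hw]; group
    subst ht1 hs1
    rfl
  · refine tco_mem_of_order hvm ?_ ?_
    · rw [hw]; exact mul_mem (inv_mem hs') hs
    · have := orderOf_injective (MulAut.conj x).toMonoidHom (MulAut.conj x).injective (t' * t⁻¹)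
      simpa using this

/-- Cardinality of a tight product. -/
lemma tco_card {H : Type*} [Group H] [Finite H] (a b : H) (ht : IsTight a b)
    (hi : Subgroup.zpowers a ⊓ Subgroup.zpowers b = ⊥) :
    Nat.card H = orderOf a * orderOf b := by
  let f : Subgroup.zpowers a × Subgroup.zpowers b → H := fun s => (s.1 : H) * (s.2 : H)
  have hf : Function.Bijective f := by
    constructor
    · exact Subgroup.mul_injective_of_disjoint (disjoint_iff.mpr hi)
    · intro g
      obtain ⟨i, j, rfl⟩ := ht g
      exact ⟨⟨⟨a ^ i, i, rfl⟩, ⟨b ^ j, j, rfl⟩⟩, rfl⟩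
  rw [← Nat.card_congr (Equiv.ofBijective f hf), Nat.card_prod, Nat.card_zpowers,
    Nat.card_zpowers]

/-- A subgroup stable under conjugation by both generators is normal. -/
lemma tco_normal {H : Type*} [Group H] [Finite H] (a b : H) (ht : IsTight a b)
    (S : Subgroup H) (h1 : ∀ s ∈ S, a * s * a⁻¹ ∈ S) (h2 : ∀ s ∈ S, b * s * b⁻¹ ∈ S) :
    S.Normal := by
  rw [← Subgroup.normalizer_eq_top_iff, eq_top_iff]
  intro g _
  obtain ⟨i, j, rfl⟩ := ht g
  exact mul_mem (Subgroup.zpow_mem _ (Subgroup.mem_normalizer_fintype h1) _)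
    (Subgroup.zpow_mem _ (Subgroup.mem_normalizer_fintype h2) _)

/-- In a group of odd order an element with trivial square is trivial. -/
lemma tco_odd {H : Type*} [Group H] [Finite H] (x : H) (h : x ^ 2 = 1)
    (ho : Odd (Nat.card H)) : x = 1 := by
  have h1 := orderOf_dvd_of_pow_eq_one h
  have h2 := orderOf_dvd_natCard x
  rw [← orderOf_eq_one_iff]
  exact Nat.eq_one_of_dvd_coprimes (Nat.coprime_two_left.mpr ho) h1 h2

/-- Elements of the first cyclic group staying there after conjugation by `b` commute with `b`. -/
lemma tco_comm {G : Type*} [Group G] [Finite G] (a b x : G) (hab : (a * b) ^ 2 = 1)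
    (hodd : Odd (orderOf b)) (hx : x ∈ Subgroup.zpowers a)
    (hbx : b * x * b⁻¹ ∈ Subgroup.zpowers a) : Commute b x := by
  have hca : ∀ y ∈ Subgroup.zpowers a, a * y = y * a := by
    rintro _ ⟨i, rfl⟩
    exact (Commute.refl a).zpow_right i
  have e1 := hca _ hx
  have e2 := hca _ hbx
  have hab' : a * b * (a * b) = 1 := by rw [← pow_two]; exact hab
  have h2 : b * b * x = x * (b * b) := by
    have c1 : a * b * x * (a * b)⁻¹ = b * x * b⁻¹ := by
      have : a * b * x * (a * b)⁻¹ = a * (b * x * b⁻¹) * a⁻¹ := by group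
      rw [this, e2, mul_inv_cancel_right]
    have c2 : a * b * (b * x * b⁻¹) * (a * b)⁻¹ = x := by
      have : a * b * (a * b * x * (a * b)⁻¹) * (a * b)⁻¹
          = (a * b * (a * b)) * x * (a * b * (a * b))⁻¹ := by group
      rw [← c1, this, hab']; group
    have c3 : b * (b * x * b⁻¹) * b⁻¹ = x := by
      have h5 : b * (b * x * b⁻¹) * b⁻¹
          = a⁻¹ * (a * b * (b * x * b⁻¹) * (a * b)⁻¹) * a := by group
      rw [h5, c2, mul_assoc, ← e1]; group
    have c4 : b * b * x = b * (b * x * b⁻¹) * b⁻¹ * (b * b) := by group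
    rw [c4, c3]
  obtain ⟨k, hk⟩ := hodd
  have h3 : b = (b * b) ^ (k + 1) := by
    rw [← pow_two, ← pow_mul, show 2 * (k + 1) = orderOf b + 1 by omega, pow_succ,
      pow_orderOf_eq_one, one_mul]
  have h4 : Commute (b * b) x := h2
  rw [h3]
  exact h4.pow_left _

lemma tco_quot_tight {G : Type*} [Group G] (a b : G) (ht : IsTight a b) (N : Subgroup G)
    [N.Normal] : IsTight (a : G ⧸ N) (b : G ⧸ N) := by
  intro g
  obtain ⟨g, rfl⟩ := QuotientGroup.mk_surjective g
  obtain ⟨i, j, rfl⟩ := ht g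
  exact ⟨i, j, rfl⟩

lemma tco_quot_disj {G : Type*} [Group G] (a b : G) (N : Subgroup G)
    [N.Normal] (h : ∀ i j : ℤ, a ^ i * b ^ j ∈ N → b ^ j ∈ N) :
    Subgroup.zpowers (a : G ⧸ N) ⊓ Subgroup.zpowers (b : G ⧸ N) = ⊥ := by
  rw [eq_bot_iff]
  rintro g ⟨⟨i, hi⟩, ⟨j, hj⟩⟩
  simp only at hi hj
  have h1 : ((a ^ (-i) * b ^ j : G) : G ⧸ N) = 1 := by
    rw [QuotientGroup.mk_mul, QuotientGroup.mk_zpow, QuotientGroup.mk_zpow, hj, zpow_neg, hi]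
    simp
  have h2 := h _ _ ((QuotientGroup.eq_one_iff _).mp h1)
  rw [Subgroup.mem_bot, ← hj, ← QuotientGroup.mk_zpow, QuotientGroup.eq_one_iff]
  exact h2

/-- The key divisibility, by induction on the order of the group. -/
lemma tco_main (n : ℕ) : ∀ {G : Type u} [Group G] [Finite G] (a b : G), Nat.card G = n →
    IsTight a b → (a * b) ^ 2 = 1 → Subgroup.zpowers a ⊓ Subgroup.zpowers b = ⊥ →
    Odd (orderOf b) → orderOf a ∣ 2 * orderOf b := by
  induction n using Nat.strong_induction_on with
  | _ n ih =>
  intro G _ _ a b hn ht hab hi hodd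
  by_cases hb1 : b = 1
  · subst hb1
    simpa using orderOf_dvd_of_pow_eq_one hab
  have hdis : ∀ g, g ∈ Subgroup.zpowers a → g ∈ Subgroup.zpowers b → g = 1 := by
    intro g h1 h2
    have : g ∈ Subgroup.zpowers a ⊓ Subgroup.zpowers b := ⟨h1, h2⟩
    rwa [hi, Subgroup.mem_bot] at this
  have hai : ∀ i : ℤ, a ^ i ∈ Subgroup.zpowers a := fun i => ⟨i, rfl⟩
  have hbi : ∀ i : ℤ, b ^ i ∈ Subgroup.zpowers b := fun i => ⟨i, rfl⟩
  have hcen : ∀ x ∈ Subgroup.zpowers a, b * x * b⁻¹ ∈ Subgroup.zpowers a →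
      x ∈ Subgroup.center G := by
    intro x hx hbx
    have h1 := tco_comm a b x hab hodd hx hbx
    have h2 : Commute a x := by
      obtain ⟨i, rfl⟩ := hx
      exact (Commute.refl a).zpow_right i
    rw [Subgroup.mem_center_iff]
    intro g
    obtain ⟨i, j, rfl⟩ := ht g
    exact (h2.zpow_left i).mul_left (h1.zpow_left j)
  obtain ⟨N, hN⟩ : ∃ N : Subgroup G, N = Subgroup.zpowers a ⊓ Subgroup.center G := ⟨_, rfl⟩
  have hNA : N ≤ Subgroup.zpowers a := hN ▸ inf_le_left
  have hNZ : N ≤ Subgroup.center G := hN ▸ inf_le_right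
  have hNn : N.Normal := by
    constructor
    intro x hx g
    have := Subgroup.mem_center_iff.mp (hNZ hx) g
    rwa [this, mul_inv_cancel_right]
  -- find `y`
  obtain ⟨y, hyb, hy1, r, z, hz, hyz⟩ : ∃ y ∈ Subgroup.zpowers b, y ≠ 1 ∧ ∃ r : ℤ, ∃ z ∈ N,
      a * y * a⁻¹ = y ^ r * z := by
    have htq := tco_quot_tight a b ht N
    have hbN : ∀ i j : ℤ, a ^ i * b ^ j ∈ N → b ^ j = 1 := by
      intro i j h
      apply hdis _ _ (hbi j)
      have := mul_mem (hai (-i)) (hNA h)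
      rwa [← mul_assoc, ← zpow_add, neg_add_cancel, zpow_zero, one_mul] at this
    have hiq := tco_quot_disj a b N (fun i j h => by rw [hbN i j h]; exact one_mem _)
    have hcq := tco_card _ _ htq hiq
    have hob : orderOf (b : G ⧸ N) = orderOf b := by
      apply Nat.dvd_antisymm (orderOf_map_dvd (QuotientGroup.mk' N) b)
      apply orderOf_dvd_of_pow_eq_one
      have h1 := pow_orderOf_eq_one (b : G ⧸ N)
      rw [← QuotientGroup.mk_pow, QuotientGroup.eq_one_iff] at h1
      have := hbN 0 (orderOf (b : G ⧸ N) : ℕ) (by simpa using h1)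
      simpa using this
    have hle : orderOf (a : G ⧸ N) ≤ orderOf b := by
      by_contra hlt
      push Not at hlt
      obtain ⟨u, ⟨k, rfl⟩, hu1, hu⟩ := tco_large (b : G ⧸ N) (a : G ⧸ N) (by
        rw [hcq, hob]
        exact Nat.mul_lt_mul_of_pos_left hlt (orderOf_pos _))
      apply hu1
      obtain ⟨l, hl⟩ := hu
      simp only [← QuotientGroup.mk_zpow, ← QuotientGroup.mk_mul, ← QuotientGroup.mk_inv] at hl ⊢
      rw [QuotientGroup.eq_one_iff, hN]
      refine ⟨hai k, hcen _ (hai k) ?_⟩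
      have h3 := hNA (QuotientGroup.eq.mp hl)
      have := mul_mem (Subgroup.zpow_mem _ (hai k) l) h3
      rwa [mul_inv_cancel_left] at this
    have hlt : orderOf (a : G ⧸ N) < orderOf b := by
      refine lt_of_le_of_ne hle ?_
      intro heq
      have h1 : ((a * b : G) : G ⧸ N) = 1 := by
        apply tco_odd
        · rw [← QuotientGroup.mk_pow, hab]; rfl
        · rw [hcq, hob, heq]; exact hodd.mul hodd
      rw [QuotientGroup.eq_one_iff] at h1
      apply hb1
      have := hbN 1 1 (by simpa using h1)
      simpa using this
    obtain ⟨u, ⟨k, rfl⟩, hu1, hu⟩ := tco_large (a : G ⧸ N) (b : G ⧸ N) (by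
      rw [hcq, hob]
      exact Nat.mul_lt_mul_of_pos_right hlt (orderOf_pos _))
    obtain ⟨l, hl⟩ := hu
    simp only [← QuotientGroup.mk_zpow, ← QuotientGroup.mk_mul, ← QuotientGroup.mk_inv] at hl hu1
    refine ⟨b ^ k, hbi k, ?_, l, _, QuotientGroup.eq.mp hl, ?_⟩
    · intro h; apply hu1; rw [h]; rfl
    · rw [mul_inv_cancel_left]
  have hzc : ∀ g, Commute g z := fun g => Subgroup.mem_center_iff.mp (hNZ hz) g
  have hzo : orderOf z ∣ orderOf y := by
    apply orderOf_dvd_of_pow_eq_one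
    have h1 : (a * y * a⁻¹) ^ orderOf y = 1 := by
      rw [conj_pow, pow_orderOf_eq_one]; group
    rw [hyz, (hzc _).mul_pow, ← zpow_natCast, ← zpow_mul, mul_comm, zpow_mul, zpow_natCast,
      pow_orderOf_eq_one, one_zpow, one_mul] at h1
    exact h1
  have hZn : (Subgroup.zpowers z).Normal := by
    constructor
    rintro _ ⟨i, rfl⟩ g
    have : g * z ^ i * g⁻¹ = z ^ i := by
      rw [((hzc g).zpow_right i).eq, mul_inv_cancel_right]
    simp only [this]
    exact ⟨i, rfl⟩
  have hby : Commute b y := by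
    obtain ⟨i, rfl⟩ := hyb
    exact (Commute.refl b).zpow_right i
  obtain ⟨L, hL⟩ : ∃ L : Subgroup G, L = Subgroup.zpowers y ⊔ Subgroup.zpowers z := ⟨_, rfl⟩
  have hyL : y ∈ L := hL ▸ (le_sup_left : _ ≤ Subgroup.zpowers y ⊔ Subgroup.zpowers z)
    (Subgroup.mem_zpowers y)
  have hzL : z ∈ L := hL ▸ (le_sup_right : _ ≤ Subgroup.zpowers y ⊔ Subgroup.zpowers z)
    (Subgroup.mem_zpowers z)
  have hmem : ∀ g, g ∈ L → ∃ s t : ℤ, g = y ^ s * z ^ t := by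
    intro g hg
    rw [hL, Subgroup.mem_sup_of_normal_right] at hg
    obtain ⟨_, ⟨s, rfl⟩, _, ⟨t, rfl⟩, h⟩ := hg
    exact ⟨s, t, h.symm⟩
  have hLn : L.Normal := by
    apply tco_normal a b ht
    · intro g hg
      obtain ⟨s, t, rfl⟩ := hmem g hg
      have : a * (y ^ s * z ^ t) * a⁻¹ = (a * y * a⁻¹) ^ s * z ^ t := by
        rw [conj_zpow, mul_assoc, mul_assoc, mul_assoc, ← ((hzc a⁻¹).zpow_right t).eq]
        group
      rw [this, hyz]
      exact mul_mem (zpow_mem (mul_mem (zpow_mem hyL r) hzL) s) (zpow_mem hzL t)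
    · intro g hg
      obtain ⟨s, t, rfl⟩ := hmem g hg
      have : Commute b (y ^ s * z ^ t) := (hby.zpow_right s).mul_right ((hzc b).zpow_right t)
      rw [this.eq, mul_inv_cancel_right]
      exact hg
  have hys : ∀ s : ℤ, y ^ s ∈ Subgroup.zpowers b := fun s => Subgroup.zpow_mem _ hyb s
  have hzt : ∀ t : ℤ, z ^ t ∈ Subgroup.zpowers a := fun t => Subgroup.zpow_mem _ (hNA hz) t
  have hsplit : ∀ i j s t : ℤ, a ^ i * b ^ j = y ^ s * z ^ t → a ^ i = z ^ t ∧ b ^ j = y ^ s := by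
    intro i j s t h
    have h1 : (z ^ t)⁻¹ * a ^ i = y ^ s * (b ^ j)⁻¹ := by
      rw [((hzc _).zpow_right t).eq] at h
      rw [inv_mul_eq_iff_eq_mul, ← mul_assoc, eq_mul_inv_iff_mul_eq, h]
    have h2 : (z ^ t)⁻¹ * a ^ i = 1 := by
      apply hdis _ (mul_mem (inv_mem (hzt t)) (hai i))
      rw [h1]
      exact mul_mem (hys s) (inv_mem (hbi j))
    rw [h2] at h1
    exact ⟨(inv_mul_eq_one.mp h2).symm, (mul_inv_eq_one.mp h1.symm).symm⟩
  have htq := tco_quot_tight a b ht L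
  have hiq := tco_quot_disj a b L (fun i j h => by
    obtain ⟨s, t, hst⟩ := hmem _ h
    rw [(hsplit i j s t hst).2]
    exact zpow_mem hyL s)
  have hqdvd : orderOf (b : G ⧸ L) ∣ orderOf b := orderOf_map_dvd (QuotientGroup.mk' L) b
  have hcard : Nat.card (G ⧸ L) < n := by
    rw [← hn, Subgroup.card_eq_card_quotient_mul_card_subgroup L]
    have h1 : 1 < Nat.card L := by
      rw [Subgroup.one_lt_card_iff_ne_bot]
      intro h
      rw [h, Subgroup.mem_bot] at hyL
      exact hy1 hyL
    exact lt_mul_of_one_lt_right Nat.card_pos h1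
  have hind := ih _ hcard (a : G ⧸ L) (b : G ⧸ L) rfl htq
    (by rw [← QuotientGroup.mk_mul, ← QuotientGroup.mk_pow, hab]; rfl) hiq
    (Odd.of_dvd_nat hodd hqdvd)
  have hA : orderOf a ∣ orderOf (a : G ⧸ L) * orderOf z := by
    have h1 := pow_orderOf_eq_one (a : G ⧸ L)
    rw [← QuotientGroup.mk_pow, QuotientGroup.eq_one_iff] at h1
    obtain ⟨s, t, hst⟩ := hmem _ h1
    have h2 := (hsplit (orderOf (a : G ⧸ L) : ℕ) 0 s t (by simpa using hst)).1
    apply orderOf_dvd_of_pow_eq_one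
    rw [pow_mul, ← zpow_natCast a, h2, ← zpow_natCast, ← zpow_mul, mul_comm, zpow_mul,
      zpow_natCast, pow_orderOf_eq_one, one_zpow]
  have hB : orderOf (b : G ⧸ L) * orderOf y ∣ orderOf b := by
    have h1 : y ∈ Subgroup.zpowers (b ^ orderOf (b : G ⧸ L)) := by
      obtain ⟨k, rfl⟩ := hyb
      simp only at hyL ⊢
      rw [← QuotientGroup.eq_one_iff, QuotientGroup.mk_zpow, ← orderOf_dvd_iff_zpow_eq_one] at hyL
      obtain ⟨c, hc⟩ := hyL
      rw [hc, zpow_mul, zpow_natCast]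
      exact ⟨c, rfl⟩
    have h2 := orderOf_dvd_of_mem_zpowers h1
    rw [orderOf_pow_of_dvd (orderOf_pos _).ne' hqdvd] at h2
    exact (Nat.mul_dvd_mul_left _ h2).trans (Nat.mul_div_cancel' hqdvd).dvd
  calc orderOf a ∣ orderOf (a : G ⧸ L) * orderOf z := hA
    _ ∣ 2 * orderOf (b : G ⧸ L) * orderOf y := Nat.mul_dvd_mul hind hzo
    _ = 2 * (orderOf (b : G ⧸ L) * orderOf y) := mul_assoc _ _ _
    _ ∣ 2 * orderOf b := Nat.mul_dvd_mul_left _ hB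

/-- For a tight chiral rotation pair of type `(p, q)` with `q` odd: `p` is even,
`p ∣ 2q`, and if `zpowers b` is core-free then `p = 2q`. -/
theorem tight_chiral_odd_q {G : Type*} [Group G] [Finite G] (a b : G) (p q : ℕ)
    (hpair : IsRotPair a b p q) (htight : IsTight a b) (hchiral : IsChiral a b)
    (hqodd : Odd q) :
    Even p ∧ p ∣ 2 * q ∧ ((Subgroup.zpowers b).normalCore = ⊥ → p = 2 * q) := by
  obtain ⟨-, rfl, rfl, hp2, hq2, hab, hi⟩ := hpair
  have hcard := tco_card a b htight hi
  have hdvd := tco_main _ a b rfl htight hab hi hqodd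
  have heven : Even (orderOf a) := by
    by_contra hne
    rw [Nat.not_even_iff_odd] at hne
    have h1 := tco_odd (a * b) hab (by rw [hcard]; exact hne.mul hqodd)
    have h2 : b ∈ Subgroup.zpowers a ⊓ Subgroup.zpowers b := by
      refine ⟨?_, Subgroup.mem_zpowers b⟩
      rw [← inv_eq_of_mul_eq_one_right h1]
      exact Subgroup.inv_mem _ (Subgroup.mem_zpowers a)
    rw [hi, Subgroup.mem_bot] at h2
    rw [h2, orderOf_one] at hq2
    omega
  refine ⟨heven, hdvd, fun hcore => ?_⟩
  have hle : orderOf b ≤ orderOf a := by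
    by_contra hlt
    push Not at hlt
    obtain ⟨u, hu, hu1, hau⟩ := tco_large a b (by
      rw [hcard]
      exact Nat.mul_lt_mul_of_pos_right hlt (by omega))
    have hn : (Subgroup.zpowers u).Normal := by
      apply tco_normal a b htight
      · rintro _ ⟨i, rfl⟩
        simp only
        rw [← conj_zpow]
        exact Subgroup.zpow_mem _ hau i
      · rintro _ ⟨i, rfl⟩
        have hc : Commute b (u ^ i) := by
          obtain ⟨j, rfl⟩ := hu
          exact ((Commute.refl b).zpow_right j).zpow_right i
        simp only
        rw [hc.eq, mul_inv_cancel_right]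
        exact ⟨i, rfl⟩
    have h1 : Subgroup.zpowers u ≤ (Subgroup.zpowers b).normalCore := by
      rw [Subgroup.normal_le_normalCore, Subgroup.zpowers_le]
      exact hu
    rw [hcore, Subgroup.zpowers_le, Subgroup.mem_bot] at h1
    exact hu1 h1
  obtain ⟨c, hc⟩ := heven
  obtain ⟨d, hd⟩ := hdvd
  obtain ⟨e, he⟩ := hqodd
  have h0 : d < 3 := by
    by_contra h
    push Not at h
    nlinarith
  interval_cases d
  · omega
  · omega
  · omega
end
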